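/- The outer measure μ coincides with the standard product probability measure π on the Borel subsets of I^ω: for every Borel subset E of the Hilbert cube I^ω (with the topology induced by d_a, which coincides with the product topology), μ(E) = π(E). -/

import Mathlib

open Filter

noncomputable section

/-- Fix a sequence `a` of positive reals with `∑ aᵢ² < ∞`.  The space
`M_a` consists of the real sequences `x` with `∑ aᵢ² xᵢ² < ∞`. -/
def Ma (a : ℕ → ℝ) : Set (ℕ → ℝ) := {x | Summable fun i => (a i) ^ 2 * (x i) ^ 2}

/-- The inner product `⟨x,y⟩_a = ∑ aᵢ² xᵢ yᵢ` on `M_a`. -/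
def innerA (a : ℕ → ℝ) (x y : ℕ → ℝ) : ℝ := ∑' i, (a i) ^ 2 * (x i * y i)

/-- The metric `d_a(x,y) = (∑ aᵢ² (xᵢ - yᵢ)²)^{1/2}`. -/
def da (a : ℕ → ℝ) (x y : ℕ → ℝ) : ℝ := Real.sqrt (∑' i, (a i) ^ 2 * (x i - y i) ^ 2)

/-- `eᵢ`: the sequence with `1` in the `i`-th coordinate and `0` elsewhere. -/
def eSeq (i : ℕ) : ℕ → ℝ := Pi.single i 1

/-- `Λ(E) = {i | ∃ x ∈ E, ∃ α ≠ 0, x + α eᵢ ∈ E}`. -/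
def Lam (E : Set (ℕ → ℝ)) : Set ℕ :=
  {i | ∃ x ∈ E, ∃ α : ℝ, α ≠ 0 ∧ x + α • eSeq i ∈ E}

/-- Convergence of the series `∑ᵢ f i` to `s` in `M_a`: the partial sums
converge to `s` with respect to the metric `d_a`. -/
def ConvSeries (a : ℕ → ℝ) (f : ℕ → ℕ → ℝ) (s : ℕ → ℝ) : Prop :=
  Tendsto (fun n => da a (∑ i ∈ Finset.range n, f i) s) atTop (nhds 0)

/-- The generalized linear span `GS(E,p)`: all points `p + ∑ᵢ αᵢ (xᵢ - p) ∈ M_a`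
with `xᵢ ∈ E`, `αᵢ ∈ ℝ`, the series converging in `M_a`. -/
def GS (a : ℕ → ℝ) (E : Set (ℕ → ℝ)) (p : ℕ → ℝ) : Set (ℕ → ℝ) :=
  {u | u ∈ Ma a ∧ ∃ x : ℕ → ℕ → ℝ, ∃ α : ℕ → ℝ,
    (∀ i, x i ∈ E) ∧ ConvSeries a (fun i => α i • (x i - p)) (u - p)}

/-- `E` is a `d_a`-bounded set. -/
def BoundedA (a : ℕ → ℝ) (E : Set (ℕ → ℝ)) : Prop :=
  ∃ C : ℝ, ∀ x ∈ E, ∀ y ∈ E, da a x y ≤ C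

/-- `f` is a `d_a`-isometry on `E`. -/
def IsIsomOn (a : ℕ → ℝ) (f : (ℕ → ℝ) → ℕ → ℝ) (E : Set (ℕ → ℝ)) : Prop :=
  ∀ x ∈ E, ∀ y ∈ E, da a (f x) (f y) = da a x y

/-- Data for a basic cylinder: each factor is a nonempty closed subinterval
`[lo i, hi i] ⊆ [0,1]`, and all but finitely many factors equal `[0,1]`. -/
def IsBCData (lo hi : ℕ → ℝ) : Prop :=
  (∀ i, 0 ≤ lo i) ∧ (∀ i, lo i ≤ hi i) ∧ (∀ i, hi i ≤ 1) ∧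
    {i | ¬(lo i = 0 ∧ hi i = 1)}.Finite

/-- The product set `∏ᵢ [lo i, hi i]`. -/
def cylSet (lo hi : ℕ → ℝ) : Set (ℕ → ℝ) := {x | ∀ i, x i ∈ Set.Icc (lo i) (hi i)}

/-- `J` is a basic cylinder. -/
def IsBasicCylinder (J : Set (ℕ → ℝ)) : Prop :=
  ∃ lo hi : ℕ → ℝ, IsBCData lo hi ∧ J = cylSet lo hi

/-- The elementary volume of a basic cylinder: the product of the lengths of its
edges (a finite product; it is `0` exactly when some factor is a singleton). -/
def bcVol (lo hi : ℕ → ℝ) : ℝ := ∏ᶠ i, (hi i - lo i)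

/-- `K` is a cylinder of volume `v`: there are a basic cylinder of elementary
volume `v` and a surjective `d_a`-isometry from it onto `K`. -/
def IsCylVol (a : ℕ → ℝ) (K : Set (ℕ → ℝ)) (v : ℝ) : Prop :=
  ∃ lo hi : ℕ → ℝ, IsBCData lo hi ∧ v = bcVol lo hi ∧
    ∃ f : (ℕ → ℝ) → ℕ → ℝ, IsIsomOn a f (cylSet lo hi) ∧ f '' cylSet lo hi = K

/-- `K` is a cylinder. -/
def IsCylinder (a : ℕ → ℝ) (K : Set (ℕ → ℝ)) : Prop := ∃ v : ℝ, IsCylVol a K v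

/-- The `d_a`-diameter of a set. -/
def daDiam (a : ℕ → ℝ) (K : Set (ℕ → ℝ)) : ℝ := sSup (Set.image2 (da a) K K)

/-- `μ_δ(E)`: the infimum of `∑ vol(Kᵢ)` over countable coverings of `E` by
cylinders of `d_a`-diameter `< δ` (`∞` if no such covering exists). -/
def preMu (a : ℕ → ℝ) (δ : ℝ) (E : Set (ℕ → ℝ)) : ENNReal :=
  sInf {m : ENNReal | ∃ (K : ℕ → Set (ℕ → ℝ)) (v : ℕ → ℝ),
    (∀ n, IsCylVol a (K n) (v n)) ∧ (∀ n, daDiam a (K n) < δ) ∧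
    (E ⊆ ⋃ n, K n) ∧ m = ∑' n, ENNReal.ofReal (v n)}

/-- The outer measure `μ(E) = lim_{δ→0⁺} μ_δ(E) = sup_{δ>0} μ_δ(E)`. -/
def muA (a : ℕ → ℝ) (E : Set (ℕ → ℝ)) : ENNReal :=
  ⨆ (δ : ℝ) (_ : 0 < δ), preMu a δ E

/-- The Hilbert cube `I^ω = [0,1]^ℕ`, viewed as a subset of `M_a`. -/
def cube : Set (ℕ → ℝ) := {x | ∀ i, x i ∈ Set.Icc (0 : ℝ) 1}

open MeasureTheory RealInnerProductSpace Topology in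
/-- The inverse of the Gaussian distribution function, as a solution of `T' = exp (π T²)`. -/
theorem exists_gaussian_transport : ∃ T : ℝ → ℝ, ∀ t ∈ Set.Ioo (-(1 / 2) : ℝ) (1 / 2),
    HasDerivAt T (Real.exp (Real.pi * T t ^ 2)) t := by
  have hcont : Continuous fun s : ℝ => Real.exp (-Real.pi * s ^ 2) := by fun_prop
  set Φ : ℝ → ℝ := fun x => ∫ s in (0 : ℝ)..x, Real.exp (-Real.pi * s ^ 2) with hΦ
  have hder : ∀ x, HasDerivAt Φ (Real.exp (-Real.pi * x ^ 2)) x := fun x =>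
    intervalIntegral.integral_hasDerivAt_right (hcont.intervalIntegrable _ _)
      (hcont.stronglyMeasurableAtFilter _ _) hcont.continuousAt
  have hΦc : Continuous Φ := continuous_iff_continuousAt.2 fun x => (hder x).continuousAt
  have hmono : StrictMono Φ := strictMono_of_deriv_pos fun x => by
    rw [(hder x).deriv]; positivity
  have hodd : ∀ x, Φ (-x) = -Φ x := by
    intro x
    have := intervalIntegral.integral_comp_neg (a := 0) (b := x)
      (fun s : ℝ => Real.exp (-Real.pi * s ^ 2))
    simp only [neg_sq, neg_zero] at this
    simp only [hΦ]
    rw [this, intervalIntegral.integral_symm]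
  have hlim : Tendsto Φ atTop (𝓝 (1 / 2)) := by
    have h := intervalIntegral_tendsto_integral_Ioi (μ := volume) (0 : ℝ)
      (integrable_exp_neg_mul_sq Real.pi_pos).integrableOn tendsto_id
    rw [integral_gaussian_Ioi] at h
    simpa [Real.pi_ne_zero, hΦ] using h
  have hsurj : ∀ t ∈ Set.Ioo (-(1 / 2) : ℝ) (1 / 2), ∃ x, Φ x = t := by
    intro t ht
    obtain ⟨x, hx⟩ := (hlim.eventually (lt_mem_nhds ht.2)).exists
    obtain ⟨y, hy⟩ := (hlim.eventually (lt_mem_nhds (show -t < 1 / 2 by linarith [ht.1]))).exists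
    exact mem_range_of_exists_le_of_exists_ge hΦc ⟨-y, by rw [hodd]; linarith⟩ ⟨x, hx.le⟩
  have hinv : ∀ t ∈ Set.Ioo (-(1 / 2) : ℝ) (1 / 2), Φ (Function.invFun Φ t) = t := fun t ht =>
    Function.invFun_eq (hsurj t ht)
  refine ⟨Function.invFun Φ, fun t ht => ?_⟩
  have hopen : Set.Ioo (-(1 / 2) : ℝ) (1 / 2) ∈ 𝓝 t := isOpen_Ioo.mem_nhds ht
  have hTmono : StrictMonoOn (Function.invFun Φ) (Set.Ioo (-(1 / 2) : ℝ) (1 / 2)) := by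
    intro u hu v hv huv
    rw [← hmono.lt_iff_lt, hinv u hu, hinv v hv]
    exact huv
  have hTc : ContinuousAt (Function.invFun Φ) t := by
    refine hTmono.continuousAt_of_image_mem_nhds hopen ?_
    refine mem_of_superset ((isOpen_Ioo.preimage hΦc).mem_nhds (x := Function.invFun Φ t)
      (by rw [Set.mem_preimage, hinv t ht]; exact ht)) fun x hx => ⟨Φ x, hx, ?_⟩
    exact Function.leftInverse_invFun hmono.injective x
  have := HasDerivAt.of_local_left_inverse hTc (hder _) (Real.exp_pos _).ne'
    (by filter_upwards [hopen] with y hy using hinv y hy)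
  rwa [← Real.exp_neg, neg_mul, neg_neg] at this

open RealInnerProductSpace in
/-- A determinant inequality of Brascamp–Lieb type for perturbations of the identity. -/
theorem prod_rpow_le_det {E ι : Type*} [NormedAddCommGroup E] [InnerProductSpace ℝ E]
    [FiniteDimensional ℝ E] [Fintype ι] (g : ι → E)
    (hg : ∀ v, ∑ k, ⟪g k, v⟫ ^ 2 ≤ ‖v‖ ^ 2) (l : ι → ℝ) (hl : ∀ k, 0 ≤ l k)
    (M : E →ₗ[ℝ] E) (hM : ∀ v, M v = v + ∑ k, ((l k - 1) * ⟪g k, v⟫) • g k) :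
    ∏ k, l k ^ (‖g k‖ ^ 2) ≤ LinearMap.det M := by
  have hsymm : M.IsSymmetric := by
    intro x y
    simp only [hM, inner_add_left, inner_add_right, sum_inner, inner_sum, inner_smul_left,
      inner_smul_right, conj_trivial]
    congr 1
    refine Finset.sum_congr rfl fun k _ => ?_
    rw [real_inner_comm (g k) x]; ring
  rw [hsymm.det_eq_prod_eigenvalues rfl]
  set v := hsymm.eigenvectorBasis rfl
  have hstep : ∀ i, ∏ k, l k ^ (⟪g k, v i⟫ ^ 2) ≤ hsymm.eigenvalues rfl i := by
    intro i
    have hv : ‖v i‖ = 1 := v.orthonormal.1 i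
    have he : hsymm.eigenvalues rfl i = 1 + ∑ k, (l k - 1) * ⟪g k, v i⟫ ^ 2 := by
      have h1 : M (v i) = (hsymm.eigenvalues rfl i : ℝ) • v i := by
        exact hsymm.apply_eigenvectorBasis rfl i
      have h2 : ⟪M (v i), v i⟫ = hsymm.eigenvalues rfl i := by
        rw [h1, inner_smul_left, real_inner_self_eq_norm_sq, hv]; simp
      rw [← h2, hM, inner_add_left, real_inner_self_eq_norm_sq, hv, sum_inner]
      simp only [inner_smul_left, conj_trivial, one_pow]
      congr 1
      exact Finset.sum_congr rfl fun k _ => by ring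
    have hb := hg (v i)
    rw [hv] at hb
    have := Real.geom_mean_le_arith_mean_weighted (Finset.univ : Finset (Option ι))
      (fun o => o.elim (1 - ∑ k, ⟪g k, v i⟫ ^ 2) fun k => ⟪g k, v i⟫ ^ 2)
      (fun o => o.elim 1 l)
      (by rintro (_ | k) _
          · simpa using hb
          · exact sq_nonneg _)
      (by simp [Fintype.sum_option])
      (by rintro (_ | k) _
          · simp
          · exact hl k)
    simp only [Fintype.prod_option, Fintype.sum_option, Option.elim, Real.one_rpow, one_mul] at this
    refine this.trans_eq ?_
    rw [he]
    simp only [sub_mul, one_mul, Finset.sum_sub_distrib, mul_one]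
    simp only [mul_comm]
    ring
  calc ∏ k, l k ^ (‖g k‖ ^ 2) = ∏ k, ∏ i, l k ^ (⟪g k, v i⟫ ^ 2) := by
        refine Finset.prod_congr rfl fun k _ => ?_
        rw [← Real.rpow_sum_of_nonneg (hl k) fun i _ => sq_nonneg _]
        congr 1
        rw [← v.sum_sq_norm_inner_left (g k)]
        simp
    _ = ∏ i, ∏ k, l k ^ (⟪g k, v i⟫ ^ 2) := Finset.prod_comm
    _ ≤ ∏ i, hsymm.eigenvalues rfl i :=
        Finset.prod_le_prod (fun i _ => Finset.prod_nonneg fun k _ => Real.rpow_nonneg (hl k) _)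
          fun i _ => hstep i
    _ = _ := by simp

open RealInnerProductSpace MeasureTheory in
/-- The geometric Brascamp–Lieb inequality for an intersection of slabs, with a defect `δ`
measuring how far the family `g` is from being a tight frame. -/
theorem volume_slabs_le {E ι : Type*} [NormedAddCommGroup E] [InnerProductSpace ℝ E]
    [FiniteDimensional ℝ E] [MeasurableSpace E] [BorelSpace E] [Fintype ι] (g : ι → E)
    (hg : ∀ v, ∑ k, ⟪g k, v⟫ ^ 2 ≤ ‖v‖ ^ 2) (q l : ι → ℝ) (hl : ∀ k, 0 < l k) (δ : ℝ)
    (Ω : Set E) (hΩ : MeasurableSet Ω) (hslab : ∀ z ∈ Ω, ∀ k, |⟪g k, z⟫ - q k| < l k / 2)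
    (hδ : ∀ z ∈ Ω, ‖z‖ ^ 2 - ∑ k, ⟪g k, z⟫ ^ 2 ≤ δ) :
    volume Ω ≤ ENNReal.ofReal
      (Real.exp (Real.pi * δ) * ∏ k, (l k / ‖g k‖) ^ (‖g k‖ ^ 2)) := by
  obtain ⟨T, hT⟩ := exists_gaussian_transport
  have hTmono : StrictMonoOn T (Set.Ioo (-(1 / 2) : ℝ) (1 / 2)) := by
    refine strictMonoOn_of_deriv_pos (convex_Ioo _ _)
      (fun t ht => (hT t ht).continuousAt.continuousWithinAt) fun t ht => ?_
    rw [interior_Ioo] at ht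
    rw [(hT t ht).deriv]; positivity
  set u : ι → E → ℝ := fun k z => (⟪g k, z⟫ - q k) / l k with hu
  have hmem : ∀ z ∈ Ω, ∀ k, u k z ∈ Set.Ioo (-(1 / 2) : ℝ) (1 / 2) := by
    intro z hz k
    have h := abs_lt.1 (hslab z hz k)
    have hk := hl k
    constructor
    · rw [hu, lt_div_iff₀ hk]; linarith [h.1]
    · rw [hu, div_lt_iff₀ hk]; linarith [h.2]
  set Y : E → E := fun z => z + ∑ k, (‖g k‖ * T (u k z) - ⟪g k, z⟫) • g k with hY
  set lam : ι → E → ℝ := fun k z => ‖g k‖ / l k * Real.exp (Real.pi * T (u k z) ^ 2) with hlam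
  set Y' : E → E →L[ℝ] E := fun z => ContinuousLinearMap.id ℝ E +
    ∑ k, ((lam k z - 1) • innerSL ℝ (g k)).smulRight (g k) with hY'
  have hder : ∀ z ∈ Ω, HasFDerivWithinAt Y (Y' z) Ω z := by
    intro z hz
    refine HasFDerivAt.hasFDerivWithinAt ?_
    refine (hasFDerivAt_id z).add (HasFDerivAt.fun_sum fun k _ => ?_)
    refine HasFDerivAt.smul_const ?_ (g k)
    have h1 : HasFDerivAt (fun z => ⟪g k, z⟫) (innerSL ℝ (g k)) z := (innerSL ℝ (g k)).hasFDerivAt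
    have h2 : HasFDerivAt (u k) ((l k)⁻¹ • innerSL ℝ (g k)) z := by
      have := (h1.sub_const (q k)).const_mul (l k)⁻¹
      refine this.congr_of_eventuallyEq (Eventually.of_forall fun x => ?_)
      simp only [hu]; ring
    have h3 := ((hT _ (hmem z hz k)).comp_hasFDerivAt z h2).const_mul ‖g k‖
    convert! h3.sub h1 using 1
    ext v
    simp [hlam]
    ring
  have hdet : ∀ z, ∏ k, lam k z ^ (‖g k‖ ^ 2) ≤ (Y' z).det := by
    intro z
    refine prod_rpow_le_det g hg (fun k => lam k z)
      (fun k => mul_nonneg (div_nonneg (norm_nonneg _) (hl k).le) (Real.exp_pos _).le) _ fun v => ?_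
    simp [hY']
  have hinj : Set.InjOn Y Ω := by
    intro z hz z' hz' hzz
    have h0 : ⟪Y z - Y z', z - z'⟫ = 0 := by rw [hzz]; simp
    have h1 : Y z - Y z' = (z - z') + ∑ k, (‖g k‖ * (T (u k z) - T (u k z')) - ⟪g k, z - z'⟫) • g k := by
      have : ∀ k, (‖g k‖ * (T (u k z) - T (u k z')) - ⟪g k, z - z'⟫) • g k =
          (‖g k‖ * T (u k z) - ⟪g k, z⟫) • g k - (‖g k‖ * T (u k z') - ⟪g k, z'⟫) • g k := by
        intro k
        rw [← sub_smul, inner_sub_right]; congr 1; ring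
      simp only [this, Finset.sum_sub_distrib, hY]
      abel
    rw [h1, inner_add_left, real_inner_self_eq_norm_sq, sum_inner] at h0
    simp only [inner_smul_left, conj_trivial, sub_mul, Finset.sum_sub_distrib] at h0
    have hB := hg (z - z')
    have huz : ∀ k, ⟪g k, z - z'⟫ = l k * (u k z - u k z') := by
      intro k
      have := (hl k).ne'
      rw [inner_sub_right, hu]; field_simp; ring
    have hterm : ∀ k, 0 ≤ ‖g k‖ * (T (u k z) - T (u k z')) * ⟪g k, z - z'⟫ ∧
        (⟪g k, z - z'⟫ ≠ 0 → 0 < ‖g k‖ * (T (u k z) - T (u k z')) * ⟪g k, z - z'⟫) := by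
      intro k
      have hlk := hl k
      by_cases hk : ⟪g k, z - z'⟫ = 0
      · simp [hk]
      have hgk : 0 < ‖g k‖ := norm_pos_iff.2 fun h => hk (by simp [h])
      have : 0 < ‖g k‖ * (T (u k z) - T (u k z')) * ⟪g k, z - z'⟫ := by
        rw [mul_assoc]
        refine mul_pos hgk ?_
        rw [huz k] at hk ⊢
        have hne : u k z - u k z' ≠ 0 := right_ne_zero_of_mul hk
        rcases lt_or_gt_of_ne (sub_ne_zero.1 hne) with h | h
        · have := hTmono (hmem z hz k) (hmem z' hz' k) h
          refine mul_pos_of_neg_of_neg (by linarith) (mul_neg_of_pos_of_neg hlk (by linarith))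
        · have := hTmono (hmem z' hz' k) (hmem z hz k) h
          exact mul_pos (by linarith) (mul_pos hlk (by linarith))
      exact ⟨this.le, fun _ => this⟩
    have hs1 : 0 ≤ ∑ k, ‖g k‖ * (T (u k z) - T (u k z')) * ⟪g k, z - z'⟫ :=
      Finset.sum_nonneg fun k _ => (hterm k).1
    have hs2 : ∑ k, ⟪g k, z - z'⟫ * ⟪g k, z - z'⟫ = ∑ k, ⟪g k, z - z'⟫ ^ 2 :=
      Finset.sum_congr rfl fun k _ => by ring
    have hs0 : ∑ k, ‖g k‖ * (T (u k z) - T (u k z')) * ⟪g k, z - z'⟫ = 0 := by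
      simp only [sub_mul, mul_sub, Finset.sum_sub_distrib] at hs1 h0 ⊢
      linarith
    have hz0 : ∀ k, ⟪g k, z - z'⟫ = 0 := by
      intro k
      by_contra hk
      have := (Finset.sum_eq_zero_iff_of_nonneg fun k _ => (hterm k).1).1 hs0 k (Finset.mem_univ k)
      exact ((hterm k).2 hk).ne' this
    simp only [hz0, mul_zero, Finset.sum_const_zero] at h0
    have : ‖z - z'‖ ^ 2 = 0 := by linarith
    exact sub_eq_zero.1 (norm_eq_zero.1 (pow_eq_zero_iff two_ne_zero |>.1 this))
  have hnorm : ∀ z, ‖Y z‖ ^ 2 ≤ ‖z‖ ^ 2 - ∑ k, ⟪g k, z⟫ ^ 2 + ∑ k, (‖g k‖ * T (u k z)) ^ 2 := by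
    intro z
    set S : ι → ℝ := fun k => ‖g k‖ * T (u k z)
    have h1 := hg (z - Y z)
    have h2 : 0 ≤ ∑ k, (S k - ⟪g k, Y z⟫) ^ 2 := Finset.sum_nonneg fun k _ => sq_nonneg _
    have h3 : ⟪Y z, Y z⟫ = ⟪z, Y z⟫ + ∑ k, (S k - ⟪g k, z⟫) * ⟪g k, Y z⟫ := by
      conv_lhs => enter [2]; rw [hY]
      simp only [inner_add_left, sum_inner, inner_smul_left, conj_trivial]
      rfl
    rw [norm_sub_sq_real] at h1
    rw [real_inner_self_eq_norm_sq] at h3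
    simp only [inner_sub_right, sub_sq, Finset.sum_add_distrib, Finset.sum_sub_distrib, sub_mul] at h1 h2 h3
    have e1 : ∑ k, 2 * ⟪g k, z⟫ * ⟪g k, Y z⟫ = 2 * ∑ k, ⟪g k, z⟫ * ⟪g k, Y z⟫ := by
      rw [Finset.mul_sum]; exact Finset.sum_congr rfl fun k _ => by ring
    have e2 : ∑ k, 2 * S k * ⟪g k, Y z⟫ = 2 * ∑ k, S k * ⟪g k, Y z⟫ := by
      rw [Finset.mul_sum]; exact Finset.sum_congr rfl fun k _ => by ring
    rw [e1] at h1
    rw [e2] at h2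
    linarith
  set A : ℝ := ∏ k, (‖g k‖ / l k) ^ (‖g k‖ ^ 2) with hA
  set A' : ℝ := ∏ k, (l k / ‖g k‖) ^ (‖g k‖ ^ 2) with hA'
  have hAA : A * A' = 1 := by
    rw [hA, hA', ← Finset.prod_mul_distrib]
    refine Finset.prod_eq_one fun k _ => ?_
    have hlk := hl k
    by_cases hk : ‖g k‖ = 0
    · simp [hk]
    have hk' : 0 < ‖g k‖ := lt_of_le_of_ne (norm_nonneg _) (Ne.symm hk)
    rw [← Real.mul_rpow (by positivity) (by positivity)]
    rw [div_mul_div_cancel₀ hlk.ne', div_self hk, Real.one_rpow]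
  have hA'0 : 0 ≤ A' := Finset.prod_nonneg fun k _ =>
    Real.rpow_nonneg (div_nonneg (hl k).le (norm_nonneg _)) _
  have hA0 : 0 < A := by
    have hAnn : 0 ≤ A := Finset.prod_nonneg fun k _ =>
      Real.rpow_nonneg (div_nonneg (norm_nonneg _) (hl k).le) _
    rcases hAnn.lt_or_eq with h | h
    · exact h
    · rw [← h] at hAA; simp at hAA
  have hpt : ∀ z ∈ Ω, A * Real.exp (-Real.pi * δ) ≤
      |(Y' z).det| * Real.exp (-Real.pi * ‖Y z‖ ^ 2) := by
    intro z hz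
    have h1 : ∏ k, lam k z ^ (‖g k‖ ^ 2) =
        A * Real.exp (Real.pi * ∑ k, (‖g k‖ * T (u k z)) ^ 2) := by
      rw [hA, Finset.mul_sum, Real.exp_sum, ← Finset.prod_mul_distrib]
      refine Finset.prod_congr rfl fun k _ => ?_
      rw [hlam, Real.mul_rpow (div_nonneg (norm_nonneg _) (hl k).le) (Real.exp_pos _).le,
        ← Real.exp_mul]
      congr 2; ring
    calc A * Real.exp (-Real.pi * δ)
        ≤ A * (Real.exp (Real.pi * ∑ k, (‖g k‖ * T (u k z)) ^ 2) *
            Real.exp (-Real.pi * ‖Y z‖ ^ 2)) := by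
          rw [← Real.exp_add]
          refine mul_le_mul_of_nonneg_left (Real.exp_le_exp.2 ?_) hA0.le
          have := mul_le_mul_of_nonneg_left ((hnorm z).trans
            (add_le_add_left (hδ z hz) _)) Real.pi_pos.le
          linarith
      _ = (∏ k, lam k z ^ (‖g k‖ ^ 2)) * Real.exp (-Real.pi * ‖Y z‖ ^ 2) := by rw [h1]; ring
      _ ≤ _ := mul_le_mul_of_nonneg_right ((hdet z).trans (le_abs_self _)) (Real.exp_pos _).le
  have hgauss : ∫⁻ y : E, ENNReal.ofReal (Real.exp (-Real.pi * ‖y‖ ^ 2)) = 1 := by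
    have hi := GaussianFourier.integral_rexp_neg_mul_sq_norm (V := E) Real.pi_pos
    rw [div_self Real.pi_ne_zero, Real.one_rpow] at hi
    rw [← ofReal_integral_eq_lintegral_ofReal, hi, ENNReal.ofReal_one]
    · refine by_contra fun hni => ?_
      rw [integral_undef hni] at hi
      exact zero_ne_one hi
    · exact Eventually.of_forall fun y => (Real.exp_pos _).le
  have hmain : ENNReal.ofReal (A * Real.exp (-Real.pi * δ)) * volume Ω ≤ 1 := by
    calc ENNReal.ofReal (A * Real.exp (-Real.pi * δ)) * volume Ω
        = ∫⁻ _ in Ω, ENNReal.ofReal (A * Real.exp (-Real.pi * δ)) := by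
          rw [setLIntegral_const]
      _ ≤ ∫⁻ z in Ω, ENNReal.ofReal |(Y' z).det| *
            ENNReal.ofReal (Real.exp (-Real.pi * ‖Y z‖ ^ 2)) := by
          refine setLIntegral_mono' hΩ fun z hz => ?_
          rw [← ENNReal.ofReal_mul (abs_nonneg _)]
          exact ENNReal.ofReal_le_ofReal (hpt z hz)
      _ = ∫⁻ y in Y '' Ω, ENNReal.ofReal (Real.exp (-Real.pi * ‖y‖ ^ 2)) :=
          (lintegral_image_eq_lintegral_abs_det_fderiv_mul volume hΩ hder hinj
            fun y => ENNReal.ofReal (Real.exp (-Real.pi * ‖y‖ ^ 2))).symm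
      _ ≤ ∫⁻ y : E, ENNReal.ofReal (Real.exp (-Real.pi * ‖y‖ ^ 2)) := setLIntegral_le_lintegral _ _
      _ = 1 := hgauss
  have hinv : Real.exp (Real.pi * δ) * A' * (A * Real.exp (-Real.pi * δ)) = 1 := by
    have : Real.exp (Real.pi * δ) * Real.exp (-Real.pi * δ) = 1 := by
      rw [← Real.exp_add]; simp
    calc _ = (A * A') * (Real.exp (Real.pi * δ) * Real.exp (-Real.pi * δ)) := by ring
      _ = 1 := by rw [this, hAA, one_mul]
  calc volume Ω = ENNReal.ofReal (Real.exp (Real.pi * δ) * A') *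
        (ENNReal.ofReal (A * Real.exp (-Real.pi * δ)) * volume Ω) := by
        rw [← mul_assoc, ← ENNReal.ofReal_mul (by positivity), hinv, ENNReal.ofReal_one, one_mul]
    _ ≤ ENNReal.ofReal (Real.exp (Real.pi * δ) * A') * 1 := by gcongr
    _ = _ := mul_one _

/-- The function `v ↦ sup_{0 < c ≤ 1} c (1 + log (v / c)) / 2`. -/
def slabEntropy (v : ℝ) : ℝ := (min v 1 + Real.log (max v 1)) / 2

theorem slabEntropy_nonneg {v : ℝ} (hv : 0 ≤ v) : 0 ≤ slabEntropy v := by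
  have h1 : 0 ≤ min v 1 := le_min hv zero_le_one
  have h2 : 0 ≤ Real.log (max v 1) := Real.log_nonneg (le_max_right _ _)
  unfold slabEntropy; linarith

theorem slabEntropy_zero : slabEntropy 0 = 0 := by simp [slabEntropy]

theorem slabEntropy_le_half (v : ℝ) : slabEntropy v ≤ v / 2 := by
  unfold slabEntropy
  rcases le_total v 1 with h | h
  · rw [min_eq_left h, max_eq_right h]; simp
  · rw [min_eq_right h, max_eq_left h]
    have := Real.log_le_sub_one_of_pos (by linarith : 0 < v)
    linarith

theorem continuous_slabEntropy : Continuous slabEntropy := by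
  unfold slabEntropy
  refine Continuous.div_const (Continuous.add (by fun_prop) ?_) _
  exact Continuous.log (by fun_prop) fun v => (lt_of_lt_of_le one_pos (le_max_right v 1)).ne'

theorem mul_log_le_slabEntropy {c v : ℝ} (hc : 0 < c) (hc1 : c ≤ 1) (hv : 0 < v) :
    c * (1 + Real.log (v / c)) / 2 ≤ slabEntropy v := by
  unfold slabEntropy
  rcases le_total v 1 with h | h
  · rw [min_eq_left h, max_eq_right h, Real.log_one]
    have h1 := Real.log_le_sub_one_of_pos (div_pos hv hc)
    have h2 : c * (1 + Real.log (v / c)) ≤ c * (v / c) :=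
      mul_le_mul_of_nonneg_left (by linarith) hc.le
    rw [mul_div_cancel₀ _ hc.ne'] at h2
    linarith
  · rw [min_eq_right h, max_eq_left h, Real.log_div hv.ne' hc.ne']
    have h1 := Real.log_le_sub_one_of_pos (inv_pos.2 hc)
    rw [Real.log_inv] at h1
    have h2 : c * -Real.log c ≤ c * (c⁻¹ - 1) := mul_le_mul_of_nonneg_left h1 hc.le
    rw [mul_sub, mul_inv_cancel₀ hc.ne'] at h2
    have h3 := Real.log_nonneg h
    have h4 : c * Real.log v ≤ 1 * Real.log v := mul_le_mul_of_nonneg_right hc1 h3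
    linarith

theorem slabEntropy_eq {v : ℝ} (hv : 0 < v) :
    slabEntropy v = min 1 v * (1 + Real.log (v / min 1 v)) / 2 := by
  unfold slabEntropy
  rcases le_total v 1 with h | h
  · rw [min_eq_left h, max_eq_right h, min_eq_right h, div_self hv.ne']; simp
  · rw [min_eq_right h, max_eq_left h, min_eq_left h]; simp

theorem mul_log_div_sqrt_le {c l κ : ℝ} (hc : 0 ≤ c) (hc1 : c ≤ 1) (hl : 0 < l) (hκ : 0 < κ) :
    c * Real.log (l / √c) ≤ slabEntropy (κ * l ^ 2) - c * (1 + Real.log κ) / 2 := by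
  rcases hc.eq_or_lt with rfl | hc
  · simpa using slabEntropy_nonneg (by positivity)
  have h := mul_log_le_slabEntropy hc hc1 (by positivity : 0 < κ * l ^ 2)
  rw [Real.log_div (by positivity) hc.ne', Real.log_mul hκ.ne' (by positivity), Real.log_pow] at h
  rw [Real.log_div hl.ne' (by positivity), Real.log_sqrt hc.le]
  push_cast at h
  linarith

open RealInnerProductSpace MeasureTheory in
/-- Volume bound for a subset of the unit cube of the scaled space cut out by slabs. -/
theorem volume_slabs_cube_le {n : ℕ} {ι : Type*} [Fintype ι] (a : Fin n → ℝ) (ha : ∀ i, 0 < a i)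
    (F : ι → Fin n → ℝ) (hF : ∀ x : Fin n → ℝ, ∑ k, (∑ i, F k i * x i) ^ 2 ≤ ∑ i, x i ^ 2)
    {κ : ℝ} (hκ : 0 < κ) (q l : ι → ℝ) (hl : ∀ k, 0 < l k) (δ : ℝ)
    (Ω : Set (Fin n → ℝ)) (hΩ : MeasurableSet Ω) (hcube : ∀ ξ ∈ Ω, ∀ i, ξ i ∈ Set.Ioo (0 : ℝ) 1)
    (hslab : ∀ ξ ∈ Ω, ∀ k, |∑ i, F k i * (a i * ξ i) - q k| < l k / 2)
    (hδ : ∀ ξ ∈ Ω, ∑ i, (a i * ξ i) ^ 2 - ∑ k, (∑ i, F k i * (a i * ξ i)) ^ 2 ≤ δ) :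
    volume Ω ≤ ENNReal.ofReal (Real.exp (Real.pi * δ + ∑ k, slabEntropy (κ * l k ^ 2) -
      ∑ i, slabEntropy (κ * a i ^ 2) +
      (1 + Real.log κ) / 2 * ∑ i, min 1 (κ * a i ^ 2) * (1 - ∑ k, F k i ^ 2))) := by
  set θ : Fin n → ℝ := fun i => min 1 (κ * a i ^ 2) with hθ
  have hθ0 : ∀ i, 0 < θ i := fun i => lt_min one_pos (by have := ha i; positivity)
  have hθ1 : ∀ i, θ i ≤ 1 := fun i => min_le_left _ _
  set s : Fin n → ℝ := fun i => a i / √(θ i) with hs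
  have hs0 : ∀ i, 0 < s i := fun i => div_pos (ha i) (Real.sqrt_pos.2 (hθ0 i))
  have hθs : ∀ i, √(θ i) * s i = a i := fun i => by
    rw [hs, mul_div_cancel₀ _ (Real.sqrt_pos.2 (hθ0 i)).ne']
  set Ω' : Set (EuclideanSpace ℝ (Fin n)) := {z | (fun i => (s i)⁻¹ * z i) ∈ Ω} with hΩ'
  have hvol : volume Ω = ENNReal.ofReal (∏ i, (s i)⁻¹) * volume Ω' := by
    have h1 : volume Ω' = volume {z : Fin n → ℝ | (fun i => (s i)⁻¹ * z i) ∈ Ω} := by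
      rw [← (PiLp.volume_preserving_ofLp (Fin n)).measure_preimage]
      · rfl
      · exact (measurable_pi_lambda _ fun i => (measurable_pi_apply i).const_mul _) hΩ
          |>.nullMeasurableSet
    have h2 := Real.smul_map_diagonal_volume_pi (D := fun i => (s i)⁻¹) (by
      rw [Matrix.det_diagonal]
      exact Finset.prod_ne_zero_iff.2 fun i _ => inv_ne_zero (hs0 i).ne')
    rw [Matrix.det_diagonal, abs_of_nonneg (Finset.prod_nonneg fun i _ => inv_nonneg.2 (hs0 i).le)]
      at h2
    conv_lhs => rw [← h2]
    rw [Measure.smul_apply, Measure.map_apply (LinearMap.continuous_of_finiteDimensional _).measurable hΩ, h1,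
      smul_eq_mul]
    congr 2
    ext z
    have : (Matrix.diagonal fun i => (s i)⁻¹).mulVec z = fun i => (s i)⁻¹ * z i :=
      funext fun i => Matrix.mulVec_diagonal _ _ _
    simp [this]
  set g : ι ⊕ Fin n → EuclideanSpace ℝ (Fin n) := Sum.elim
    (fun k => WithLp.toLp 2 fun i => √(θ i) * F k i)
    (fun i => √(1 - θ i) • EuclideanSpace.single i (1 : ℝ)) with hg
  have hgl : ∀ k z, ⟪g (Sum.inl k), z⟫ = ∑ i, F k i * (√(θ i) * z i) := by
    intro k z
    simp only [hg, Sum.elim_inl, PiLp.inner_apply]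
    refine Finset.sum_congr rfl fun i _ => ?_
    simp
    ring
  have hgr : ∀ i z, ⟪g (Sum.inr i), z⟫ = √(1 - θ i) * z i := by
    intro i z
    simp [hg, inner_smul_left, EuclideanSpace.inner_single_left]
  have hsum : ∀ z : EuclideanSpace ℝ (Fin n), ‖z‖ ^ 2 - ∑ k, ⟪g k, z⟫ ^ 2 =
      ∑ i, (√(θ i) * z i) ^ 2 - ∑ k, (∑ i, F k i * (√(θ i) * z i)) ^ 2 := by
    intro z
    rw [Fintype.sum_sum_type]
    simp only [hgl, hgr, EuclideanSpace.real_norm_sq_eq, mul_pow, Real.sq_sqrt (hθ0 _).le,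
      Real.sq_sqrt (sub_nonneg.2 (hθ1 _))]
    simp only [sub_mul, one_mul, Finset.sum_sub_distrib]
    ring
  have hgn : ∀ k, ‖g (Sum.inl k)‖ ^ 2 = ∑ i, θ i * F k i ^ 2 := by
    intro k
    simp [hg, EuclideanSpace.real_norm_sq_eq, mul_pow, Real.sq_sqrt (hθ0 _).le]
  have hgn' : ∀ i, ‖g (Sum.inr i)‖ = √(1 - θ i) := by
    intro i
    simp [hg, norm_smul, abs_of_nonneg]
  set c : ι → ℝ := fun k => ∑ i, θ i * F k i ^ 2 with hc
  have hc0 : ∀ k, 0 ≤ c k := fun k => Finset.sum_nonneg fun i _ => mul_nonneg (hθ0 i).le (sq_nonneg _)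
  have hc1 : ∀ k, c k ≤ 1 := by
    intro k
    have h1 : c k ≤ ∑ i, F k i ^ 2 := Finset.sum_le_sum fun i _ =>
      mul_le_of_le_one_left (sq_nonneg _) (hθ1 i)
    have h2 := (Finset.single_le_sum (f := fun k' => (∑ i, F k' i * F k i) ^ 2)
      (fun _ _ => sq_nonneg _) (Finset.mem_univ k)).trans (hF (F k))
    simp only [← sq] at h2
    nlinarith
  have hgn2 : ∀ k, ‖g (Sum.inl k)‖ = √(c k) := fun k => by
    rw [show c k = ‖g (Sum.inl k)‖ ^ 2 from (hgn k).symm, Real.sqrt_sq (norm_nonneg _)]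
  have hza : ∀ (z : EuclideanSpace ℝ (Fin n)) i, a i * ((s i)⁻¹ * z i) = √(θ i) * z i := by
    intro z i
    have := (hs0 i).ne'
    rw [← hθs i]
    field_simp
  have key := volume_slabs_le g (fun z => by
      have := hsum z
      have := hF fun i => √(θ i) * z i
      linarith)
    (Sum.elim q fun i => √(1 - θ i) * s i / 2)
    (Sum.elim l fun i => if θ i = 1 then 1 else √(1 - θ i) * s i)
    (by
      rintro (k | i)
      · exact hl k
      · simp only [Sum.elim_inr]
        split_ifs with h
        · exact one_pos
        · exact mul_pos (Real.sqrt_pos.2 (sub_pos.2 (lt_of_le_of_ne (hθ1 i) h))) (hs0 i))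
    δ Ω' (by
      refine measurableSet_preimage ?_ hΩ
      fun_prop)
    (by
      rintro z hz (k | i)
      · rw [hgl]
        have := hslab _ hz k
        simp only [hza] at this
        exact this
      · rw [hgr]
        simp only [Sum.elim_inr]
        split_ifs with h
        · simp [h]
        · have h1 := hcube _ hz i
          have hp : 0 < √(1 - θ i) * s i :=
            mul_pos (Real.sqrt_pos.2 (sub_pos.2 (lt_of_le_of_ne (hθ1 i) h))) (hs0 i)
          have h2 : √(1 - θ i) * z i = √(1 - θ i) * s i * ((s i)⁻¹ * z i) := by
            have := (hs0 i).ne'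
            field_simp
          rw [h2, abs_lt]
          constructor <;> nlinarith [h1.1, h1.2])
    (by
      intro z hz
      rw [hsum]
      have := hδ _ hz
      simp only [hza] at this
      exact this)
  rw [hvol]
  refine (mul_le_mul_right key _).trans ?_
  rw [← ENNReal.ofReal_mul (Finset.prod_nonneg fun i _ => inv_nonneg.2 (hs0 i).le)]
  refine ENNReal.ofReal_le_ofReal ?_
  rw [Fintype.prod_sum_type]
  have hL : ∏ k, (l k / ‖g (Sum.inl k)‖) ^ (‖g (Sum.inl k)‖ ^ 2) ≤
      Real.exp (∑ k, (slabEntropy (κ * l k ^ 2) - c k * (1 + Real.log κ) / 2)) := by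
    rw [Real.exp_sum]
    refine Finset.prod_le_prod (fun k _ => Real.rpow_nonneg
      (div_nonneg (hl k).le (norm_nonneg _)) _) fun k _ => ?_
    refine le_trans ?_ (Real.exp_le_exp.2 (mul_log_div_sqrt_le (hc0 k) (hc1 k) (hl k) hκ))
    rw [hgn2, Real.sq_sqrt (hc0 k)]
    rcases (hc0 k).eq_or_lt with h | h
    · simp [← h]
    · rw [Real.rpow_def_of_pos (div_pos (hl k) (Real.sqrt_pos.2 h)), mul_comm]
  have hR : ∏ i, ((s i)⁻¹ * ((if θ i = 1 then 1 else √(1 - θ i) * s i) / ‖g (Sum.inr i)‖) ^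
      (‖g (Sum.inr i)‖ ^ 2)) = Real.exp (∑ i, (θ i * (1 + Real.log κ) / 2 -
        slabEntropy (κ * a i ^ 2))) := by
    rw [Real.exp_sum]
    refine Finset.prod_congr rfl fun i _ => ?_
    rw [hgn', Real.sq_sqrt (sub_nonneg.2 (hθ1 i))]
    have h1 : ((if θ i = 1 then 1 else √(1 - θ i) * s i) / √(1 - θ i)) ^ (1 - θ i) =
        s i ^ (1 - θ i) := by
      split_ifs with h
      · simp [h]
      · rw [mul_div_cancel_left₀]
        exact (Real.sqrt_pos.2 (sub_pos.2 (lt_of_le_of_ne (hθ1 i) h))).ne'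
    have hai := ha i
    rw [h1, ← Real.rpow_neg_one, ← Real.rpow_add (hs0 i), Real.rpow_def_of_pos (hs0 i),
      slabEntropy_eq (by positivity)]
    change _ = Real.exp (_ - θ i * (1 + Real.log (κ * a i ^ 2 / θ i)) / 2)
    rw [Real.log_div (by positivity) (hθ0 i).ne', Real.log_mul hκ.ne' (by positivity),
      Real.log_pow]
    have : Real.log (s i) = Real.log (a i) - Real.log (θ i) / 2 := by
      rw [hs, Real.log_div hai.ne' (Real.sqrt_pos.2 (hθ0 i)).ne', Real.log_sqrt (hθ0 i).le]
    rw [this]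
    congr 1
    push_cast
    ring
  have hcθ : ∑ k, c k = ∑ i, θ i * ∑ k, F k i ^ 2 := by
    rw [hc, Finset.sum_comm]
    exact Finset.sum_congr rfl fun i _ => (Finset.mul_sum _ _ _).symm
  rw [Finset.prod_mul_distrib] at hR
  simp only [Sum.elim_inl, Sum.elim_inr]
  calc _ = Real.exp (Real.pi * δ) * (∏ k, (l k / ‖g (Sum.inl k)‖) ^ (‖g (Sum.inl k)‖ ^ 2)) *
        ((∏ i, (s i)⁻¹) * ∏ i, ((if θ i = 1 then 1 else √(1 - θ i) * s i) / ‖g (Sum.inr i)‖) ^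
      (‖g (Sum.inr i)‖ ^ 2)) := by ring
    _ ≤ Real.exp (Real.pi * δ) *
        Real.exp (∑ k, (slabEntropy (κ * l k ^ 2) - c k * (1 + Real.log κ) / 2)) *
        Real.exp (∑ i, (θ i * (1 + Real.log κ) / 2 - slabEntropy (κ * a i ^ 2))) := by
      rw [hR]; gcongr
    _ = _ := by
      rw [← Real.exp_add, ← Real.exp_add]
      congr 1
      have e1 : ∑ k, c k * (1 + Real.log κ) / 2 = (∑ k, c k) * (1 + Real.log κ) / 2 := by
        rw [Finset.sum_mul, Finset.sum_div]
      have e2 : ∑ i, θ i * (1 + Real.log κ) / 2 = (∑ i, θ i) * (1 + Real.log κ) / 2 := by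
        rw [Finset.sum_mul, Finset.sum_div]
      change _ = _ + _ / 2 * ∑ i, θ i * _
      simp only [Finset.sum_sub_distrib, mul_sub, mul_one]
      rw [e1, e2, hcθ]
      ring

open MeasureTheory in
/-- The finite-dimensional marginals of the product measure on the cube are Lebesgue measure. -/
theorem map_restrict_cube (π : Measure (ℕ → ℝ))
    (hπ : ∀ lo hi : ℕ → ℝ, IsBCData lo hi → π (cylSet lo hi) = ENNReal.ofReal (bcVol lo hi))
    (n : ℕ) :
    (π.restrict cube).map (fun ξ (i : Fin n) => ξ i) =
      (volume : Measure (Fin n → ℝ)).restrict (Set.univ.pi fun _ => Set.Icc (0 : ℝ) 1) := by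
  have hmeas : Measurable fun (ξ : ℕ → ℝ) (i : Fin n) => ξ i :=
    measurable_pi_lambda _ fun i => measurable_pi_apply _
  rw [volume_pi, Measure.restrict_pi_pi]
  symm
  refine Measure.pi_eq_generateFrom
    (C := fun _ => {S | ∃ l u : ℝ, l ≤ u ∧ Set.Icc l u = S}) (fun _ => ?_)
    (fun _ => isPiSystem_Icc id id)
    (fun _ => ⟨fun k => Set.Icc (-(k : ℝ)) k, fun k => ⟨-k, k, by
      have : (0 : ℝ) ≤ k := k.cast_nonneg
      linarith, rfl⟩, fun k => measure_lt_top _ _, ?_⟩) ?_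
  · rw [← borel_eq_generateFrom_Icc]
    exact (BorelSpace.measurable_eq (α := ℝ)).symm
  · refine Set.eq_univ_of_forall fun x => ?_
    obtain ⟨k, hk⟩ := exists_nat_ge |x|
    exact Set.mem_iUnion.2 ⟨k, abs_le.1 hk⟩
  intro s hs
  choose l u hlu hs using hs
  have hsm : MeasurableSet (Set.univ.pi s) :=
    MeasurableSet.univ_pi fun i => by rw [← hs i]; exact measurableSet_Icc
  rw [Measure.map_apply hmeas hsm, Measure.restrict_apply (hmeas hsm)]
  have hR : ∀ i, (volume.restrict (Set.Icc (0 : ℝ) 1)) (s i) =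
      ENNReal.ofReal (min (u i) 1 - max (l i) 0) := by
    intro i
    rw [← hs i, Measure.restrict_apply measurableSet_Icc, Set.Icc_inter_Icc, Real.volume_Icc]
  rw [Finset.prod_congr rfl fun i _ => hR i]
  set lo : ℕ → ℝ := fun i => if h : i < n then max (l ⟨i, h⟩) 0 else 0 with hlo
  set hi : ℕ → ℝ := fun i => if h : i < n then min (u ⟨i, h⟩) 1 else 1 with hhi
  have hset : (fun (ξ : ℕ → ℝ) (i : Fin n) => ξ i) ⁻¹' Set.univ.pi s ∩ cube = cylSet lo hi := by
    ext ξ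
    simp only [Set.mem_inter_iff, Set.mem_preimage, Set.mem_pi, Set.mem_univ, true_imp_iff, cube,
      cylSet, Set.mem_ofPred_eq, ← hs, Set.mem_Icc]
    constructor
    · rintro ⟨h1, h2⟩ i
      simp only [hlo, hhi]
      split_ifs with h
      · exact ⟨max_le (h1 ⟨i, h⟩).1 (h2 i).1, le_min (h1 ⟨i, h⟩).2 (h2 i).2⟩
      · exact h2 i
    · intro h
      refine ⟨fun i => ?_, fun i => ?_⟩
      · have := h i
        simp only [hlo, hhi, i.2, dif_pos, sup_le_iff, le_inf_iff] at this
        exact ⟨this.1.1, this.2.1⟩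
      · have := h i
        simp only [hlo, hhi] at this
        split_ifs at this with h
        · simp only [sup_le_iff, le_inf_iff] at this
          exact ⟨this.1.2, this.2.2⟩
        · exact this
  rw [hset]
  by_cases hne : ∀ i : Fin n, max (l i) 0 ≤ min (u i) 1
  · rw [hπ lo hi]
    · have : bcVol lo hi = ∏ i : Fin n, (min (u i) 1 - max (l i) 0) := by
        rw [bcVol, finprod_eq_prod_of_mulSupport_subset (s := Finset.range n), Finset.prod_range]
        · simp [hlo, hhi]
        · intro i hi'
          by_contra h
          simp only [Finset.coe_range, Set.mem_Iio] at h
          simp [hlo, hhi, h] at hi'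
      rw [this, ENNReal.ofReal_prod_of_nonneg]
      exact fun i _ => sub_nonneg.2 (hne i)
    · refine ⟨fun i => ?_, fun i => ?_, fun i => ?_, (Set.finite_lt_nat n).subset fun i hi' => ?_⟩
      · simp only [hlo]; split_ifs <;> simp
      · simp only [hlo, hhi]; split_ifs
        · exact hne _
        · exact zero_le_one
      · simp only [hhi]; split_ifs <;> simp
      · by_contra h
        simp only [Set.mem_ofPred_eq] at h
        simp [hlo, hhi, h] at hi'
  · push Not at hne
    obtain ⟨i, hi'⟩ := hne
    rw [Finset.prod_eq_zero (Finset.mem_univ i) (ENNReal.ofReal_of_nonpos (by linarith))]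
    convert! measure_empty (μ := π)
    refine Set.eq_empty_of_forall_notMem fun ξ hξ => ?_
    have := hξ i
    simp only [hlo, hhi, i.2, dif_pos, Set.mem_Icc, Fin.eta] at this
    linarith [this.1, this.2]

open MeasureTheory in
theorem measure_le_volume_of_subset (π : Measure (ℕ → ℝ))
    (hπ : ∀ lo hi : ℕ → ℝ, IsBCData lo hi → π (cylSet lo hi) = ENNReal.ofReal (bcVol lo hi))
    (n : ℕ) {D : Set (ℕ → ℝ)} (hD : D ⊆ cube) (Ω : Set (Fin n → ℝ)) (hΩ : MeasurableSet Ω)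
    (hDΩ : ∀ ξ ∈ D, (fun i : Fin n => ξ i) ∈ Ω) :
    π D ≤ volume (Ω ∩ Set.univ.pi fun _ => Set.Ioo (0 : ℝ) 1) := by
  have hmeas : Measurable fun (ξ : ℕ → ℝ) (i : Fin n) => ξ i :=
    measurable_pi_lambda _ fun i => measurable_pi_apply _
  have h1 : volume (Ω ∩ Set.univ.pi fun _ => Set.Ioo (0 : ℝ) 1) =
      volume (Ω ∩ Set.univ.pi fun _ => Set.Icc (0 : ℝ) 1) := by
    refine measure_congr ((ae_eq_refl Ω).inter ?_)
    rw [Set.pi_univ_Icc]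
    exact Measure.univ_pi_Ioo_ae_eq_Icc
  have h2 := congrArg (fun m => m Ω) (map_restrict_cube π hπ n)
  simp only [Measure.map_apply hmeas hΩ, Measure.restrict_apply hΩ,
    Measure.restrict_apply (hmeas hΩ)] at h2
  rw [h1, ← h2]
  exact measure_mono fun ξ hξ => ⟨hDΩ ξ hξ, hD hξ⟩

section Residual

open RealInnerProductSpace

variable {H ι : Type*} [NormedAddCommGroup H] [InnerProductSpace ℝ H]

/-- The component of a vector orthogonal to the span of finitely many basis vectors. -/
def orthoResidual (b : ι → H) (t : Finset ι) : H →ₗ[ℝ] H :=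
  LinearMap.id - ∑ k ∈ t, (innerₛₗ ℝ (b k)).smulRight (b k)

theorem orthoResidual_apply (b : ι → H) (t : Finset ι) (x : H) :
    orthoResidual b t x = x - ∑ k ∈ t, ⟪b k, x⟫ • b k := by
  simp [orthoResidual]

theorem norm_sum_smul_sq {b : ι → H} (hb : Orthonormal ℝ b) (c : ι → ℝ) (t : Finset ι) :
    ‖∑ k ∈ t, c k • b k‖ ^ 2 = ∑ k ∈ t, c k ^ 2 := by
  rw [← real_inner_self_eq_norm_sq, hb.inner_sum]
  simp [sq]

theorem norm_orthoResidual_sq {b : ι → H} (hb : Orthonormal ℝ b) (t : Finset ι) (x : H) :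
    ‖orthoResidual b t x‖ ^ 2 = ‖x‖ ^ 2 - ∑ k ∈ t, ⟪b k, x⟫ ^ 2 := by
  rw [orthoResidual_apply, norm_sub_sq_real, norm_sum_smul_sq hb, inner_sum]
  have : ∀ k, ⟪x, ⟪b k, x⟫ • b k⟫ = ⟪b k, x⟫ ^ 2 := fun k => by
    rw [inner_smul_right, real_inner_comm, sq]
  simp only [this]
  ring

theorem norm_orthoResidual_le {b : ι → H} (hb : Orthonormal ℝ b) (t : Finset ι) (x : H) :
    ‖orthoResidual b t x‖ ≤ ‖x‖ := by
  refine (sq_le_sq₀ (norm_nonneg _) (norm_nonneg _)).1 ?_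
  rw [norm_orthoResidual_sq hb]
  have : 0 ≤ ∑ k ∈ t, ⟪b k, x⟫ ^ 2 := Finset.sum_nonneg fun _ _ => sq_nonneg _
  linarith

theorem tendsto_orthoResidual (b : HilbertBasis ι ℝ H) (x : H) :
    Tendsto (fun t => orthoResidual b t x) atTop (nhds 0) := by
  have h : Tendsto (fun t => ∑ k ∈ t, ⟪b k, x⟫ • b k) atTop (nhds x) := by
    have := b.hasSum_repr x
    simp only [b.repr_apply_apply] at this
    exact this
  simpa [orthoResidual_apply] using h.const_sub x

theorem sum_le_tsum_add {f : ℕ → ℝ} (hf : ∀ i, 0 ≤ f i) (hs : Summable f) (m : ℕ) (s : Finset ℕ)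
    (h : ∀ i ∈ s, m ≤ i) : ∑ i ∈ s, f i ≤ ∑' i, f (i + m) := by
  have h1 := hs.sum_add_tsum_nat_add m
  have hd : Disjoint (Finset.range m) s := Finset.disjoint_left.2 fun i hi hi' => by
    have := h i hi'
    have := Finset.mem_range.1 hi
    omega
  have h2 := hs.sum_le_tsum (Finset.range m ∪ s) (fun i _ => hf i)
  rw [Finset.sum_union hd] at h2
  linarith

theorem norm_sum_smul_le_sqrt_tail {e : ℕ → H} (he : Orthonormal ℝ e) {a : ℕ → ℝ}
    (hsum : Summable fun i => a i ^ 2) (m : ℕ) (s : Finset ℕ) (h : ∀ i ∈ s, m ≤ i) {ξ : ℕ → ℝ}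
    (hξ : ξ ∈ cube) :
    ‖∑ i ∈ s, (a i * ξ i) • e i‖ ≤ √(∑' i, a (i + m) ^ 2) := by
  refine Real.le_sqrt_of_sq_le ?_
  rw [norm_sum_smul_sq he]
  refine le_trans (Finset.sum_le_sum fun i _ => ?_)
    (sum_le_tsum_add (fun i => sq_nonneg (a i)) hsum m s h)
  rw [mul_pow]
  exact mul_le_of_le_one_right (sq_nonneg _) (pow_le_one₀ (hξ i).1 (hξ i).2)

theorem exists_finset_residual_le {e : ℕ → H} (he : Orthonormal ℝ e) (b : HilbertBasis ι ℝ H)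
    {a : ℕ → ℝ} (ha : ∀ i, 0 < a i) (hsum : Summable fun i => a i ^ 2) {κ : ℝ} (hκ : 0 < κ)
    {ε : ℝ} (hε : 0 < ε) : ∃ t : Finset ι,
      (∀ n, ∑ i ∈ Finset.range n, min 1 (κ * a i ^ 2) * ‖orthoResidual b t (e i)‖ ^ 2 ≤ ε) ∧
      ∀ n, ∀ ξ ∈ cube, ‖orthoResidual b t (∑ i ∈ Finset.range n, (a i * ξ i) • e i)‖ ^ 2 ≤ ε := by
  have htail := tendsto_sum_nat_add fun i => a i ^ 2
  have h1 : ∀ᶠ m in atTop, κ * ∑' i, a (i + m) ^ 2 < ε / 2 := by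
    have := htail.const_mul κ
    rw [mul_zero] at this
    exact this.eventually_lt_const (by positivity)
  have h2 : ∀ᶠ m in atTop, √(∑' i, a (i + m) ^ 2) < √ε / 2 := by
    have := htail.sqrt
    rw [Real.sqrt_zero] at this
    exact this.eventually_lt_const (by positivity)
  obtain ⟨m, hm1, hm2⟩ := (h1.and h2).exists
  have h3 : ∀ᶠ t in atTop, ∑ i ∈ Finset.range m, ‖orthoResidual b t (e i)‖ ^ 2 < ε / 2 := by
    have : Tendsto (fun t => ∑ i ∈ Finset.range m, ‖orthoResidual b t (e i)‖ ^ 2) atTop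
        (nhds (∑ i ∈ Finset.range m, ‖(0 : H)‖ ^ 2)) :=
      tendsto_finsetSum _ fun i _ => (tendsto_orthoResidual b (e i)).norm.pow 2
    simp only [norm_zero, ne_eq, OfNat.ofNat_ne_zero, not_false_eq_true, zero_pow,
      Finset.sum_const_zero] at this
    exact this.eventually_lt_const (by positivity)
  have h4 : ∀ᶠ t in atTop, ∑ i ∈ Finset.range m, a i * ‖orthoResidual b t (e i)‖ < √ε / 2 := by
    have : Tendsto (fun t => ∑ i ∈ Finset.range m, a i * ‖orthoResidual b t (e i)‖) atTop
        (nhds (∑ i ∈ Finset.range m, a i * ‖(0 : H)‖)) :=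
      tendsto_finsetSum _ fun i _ => (tendsto_orthoResidual b (e i)).norm.const_mul _
    simp only [norm_zero, mul_zero, Finset.sum_const_zero] at this
    exact this.eventually_lt_const (by positivity)
  obtain ⟨t, ht1, ht2⟩ := (h3.and h4).exists
  refine ⟨t, fun n => ?_, fun n ξ hξ => ?_⟩
  · rw [← Finset.sum_filter_add_sum_filter_not _ (fun i => i < m)]
    have hA : ∑ i ∈ (Finset.range n).filter (· < m), min 1 (κ * a i ^ 2) * ‖orthoResidual b t (e i)‖ ^ 2 ≤
        ∑ i ∈ Finset.range m, ‖orthoResidual b t (e i)‖ ^ 2 := by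
      refine (Finset.sum_le_sum fun i _ => mul_le_of_le_one_left (sq_nonneg _)
        (min_le_left _ _)).trans ?_
      refine Finset.sum_le_sum_of_subset_of_nonneg (fun i hi => ?_) fun _ _ _ => sq_nonneg _
      exact Finset.mem_range.2 (Finset.mem_filter.1 hi).2
    have hB : ∑ i ∈ (Finset.range n).filter (¬ · < m),
        min 1 (κ * a i ^ 2) * ‖orthoResidual b t (e i)‖ ^ 2 ≤ κ * ∑' i, a (i + m) ^ 2 := by
      rw [← tsum_mul_left]
      refine le_trans (Finset.sum_le_sum fun i _ => ?_) (sum_le_tsum_add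
        (f := fun i => κ * a i ^ 2) (fun i => by positivity) (hsum.mul_left κ) m _
        fun i hi => not_lt.1 (Finset.mem_filter.1 hi).2)
      have : ‖orthoResidual b t (e i)‖ ^ 2 ≤ 1 := by
        refine pow_le_one₀ (norm_nonneg _) ((norm_orthoResidual_le b.orthonormal t _).trans_eq ?_)
        exact he.norm_eq_one i
      have hai := ha i
      exact (mul_le_of_le_one_right (by positivity) this).trans (min_le_right _ _)
    linarith
  · rw [← Finset.sum_filter_add_sum_filter_not _ (fun i => i < m), map_add]
    have hA : ‖orthoResidual b t (∑ i ∈ (Finset.range n).filter (· < m), (a i * ξ i) • e i)‖ ≤ √ε / 2 := by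
      rw [map_sum]
      refine (norm_sum_le _ _).trans (le_trans ?_ ht2.le)
      refine le_trans (Finset.sum_le_sum (g := fun i => a i * ‖orthoResidual b t (e i)‖) fun i _ => ?_)
        (Finset.sum_le_sum_of_subset_of_nonneg (fun i hi => ?_) fun i _ _ =>
          mul_nonneg (ha i).le (norm_nonneg _))
      · rw [map_smul, norm_smul, Real.norm_eq_abs,
          abs_of_nonneg (mul_nonneg (ha i).le (hξ i).1)]
        exact mul_le_mul_of_nonneg_right (mul_le_of_le_one_right (ha i).le (hξ i).2) (norm_nonneg _)
      · exact Finset.mem_range.2 (Finset.mem_filter.1 hi).2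
    have hB : ‖orthoResidual b t (∑ i ∈ (Finset.range n).filter (¬ · < m), (a i * ξ i) • e i)‖ ≤ √ε / 2 :=
      (norm_orthoResidual_le b.orthonormal t _).trans ((norm_sum_smul_le_sqrt_tail he hsum m _
        (fun i hi => not_lt.1 (Finset.mem_filter.1 hi).2) hξ).trans hm2.le)
    have hC := norm_add_le_of_le hA hB
    rw [add_halves] at hC
    exact (Real.le_sqrt (norm_nonneg _) hε.le).1 hC

end Residual

theorem summable_slabEntropy {ι : Type*} {f : ι → ℝ} (hf : ∀ i, 0 ≤ f i) (hs : Summable f) :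
    Summable fun i => slabEntropy (f i) :=
  Summable.of_nonneg_of_le (fun i => slabEntropy_nonneg (hf i))
    (fun i => slabEntropy_le_half (f i)) (hs.div_const 2)

open RealInnerProductSpace MeasureTheory in
/-- An infinite-dimensional Brascamp–Lieb bound: a part of the Hilbert cube contained in a brick
with edges `B k` along an orthonormal basis `b` has small measure. -/
theorem measure_le_of_hilbertBasis {H ι : Type*} [NormedAddCommGroup H] [InnerProductSpace ℝ H]
    (a : ℕ → ℝ) (ha : ∀ i, 0 < a i) (hsum : Summable fun i => a i ^ 2) (π : Measure (ℕ → ℝ))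
    (hπ : ∀ lo hi : ℕ → ℝ, IsBCData lo hi → π (cylSet lo hi) = ENNReal.ofReal (bcVol lo hi))
    {e : ℕ → H} (he : Orthonormal ℝ e) (b : HilbertBasis ι ℝ H) (q B : ι → ℝ) (hB : ∀ k, 0 ≤ B k)
    {κ : ℝ} (hκ : 1 ≤ κ) (C : ℝ)
    (hC : ∀ t : Finset ι, ∑ k ∈ t, slabEntropy (κ * B k ^ 2) ≤ C) {D : Set (ℕ → ℝ)}
    (hD : D ⊆ cube) (hDb : ∀ ξ ∈ D, ∃ x, HasSum (fun i => (a i * ξ i) • e i) x ∧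
      ∀ k, ⟪b k, x⟫ ∈ Set.Icc (q k) (q k + B k)) :
    π D ≤ ENNReal.ofReal (Real.exp (C - ∑' i, slabEntropy (κ * a i ^ 2))) := by
  have hκ0 : 0 < κ := by linarith
  have hsG : Summable fun i => slabEntropy (κ * a i ^ 2) :=
    summable_slabEntropy (fun i => by positivity) (hsum.mul_left κ)
  set S := ∑' i, slabEntropy (κ * a i ^ 2) with hS
  set c := Real.pi + 2 + (1 + Real.log κ) / 2 with hc
  have hmain : ∀ ε : ℝ, 0 < ε → π D ≤ ENNReal.ofReal (Real.exp (C - S + c * ε)) := by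
    intro ε hε
    obtain ⟨t, ht1, ht2⟩ := exists_finset_residual_le he b ha hsum hκ0 hε
    obtain ⟨η, hη, hηC⟩ : ∃ η : ℝ, 0 < η ∧
        ∑ k ∈ t, slabEntropy (κ * (B k + η) ^ 2) ≤ C + ε := by
      have hcont : Continuous fun η : ℝ => ∑ k ∈ t, slabEntropy (κ * (B k + η) ^ 2) :=
        continuous_finsetSum _ fun k _ => continuous_slabEntropy.comp (by fun_prop)
      have h0 : ∀ᶠ η in nhds (0 : ℝ), ∑ k ∈ t, slabEntropy (κ * (B k + η) ^ 2) < C + ε := by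
        refine hcont.continuousAt.eventually_lt_const ?_
        simp only [add_zero]
        linarith [hC t]
      obtain ⟨r, hr, hball⟩ := Metric.eventually_nhds_iff.1 h0
      refine ⟨r / 2, by positivity, (hball ?_).le⟩
      rw [Real.dist_eq, sub_zero, abs_of_pos (by positivity)]
      linarith
    have h1 : ∀ᶠ n in atTop, √(∑' i, a (i + n) ^ 2) < η / 2 := by
      have := (tendsto_sum_nat_add fun i => a i ^ 2).sqrt
      rw [Real.sqrt_zero] at this
      exact this.eventually_lt_const (by positivity)
    have h2 : ∀ᶠ n in atTop, S - ε < ∑ i ∈ Finset.range n, slabEntropy (κ * a i ^ 2) :=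
      hsG.hasSum.tendsto_sum_nat.eventually_const_lt (by linarith)
    obtain ⟨n, hn1, hn2⟩ := (h1.and h2).exists
    set F : t → Fin n → ℝ := fun k i => ⟪b k, e i⟫ with hF
    have he' : Orthonormal ℝ fun i : Fin n => e i := he.comp _ Fin.val_injective
    have hFx : ∀ (k : t) (x : Fin n → ℝ), ∑ i, F k i * x i = ⟪b k, ∑ i : Fin n, x i • e i⟫ := by
      intro k x
      rw [inner_sum]
      refine Finset.sum_congr rfl fun i _ => ?_
      rw [inner_smul_right, mul_comm]
    have hres : ∀ x : H, ‖x‖ ^ 2 - ∑ k : t, ⟪b k, x⟫ ^ 2 = ‖orthoResidual b t x‖ ^ 2 := by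
      intro x
      rw [norm_orthoResidual_sq b.orthonormal, ← Finset.sum_coe_sort t fun k => ⟪b k, x⟫ ^ 2]
    have hFF : ∀ x : Fin n → ℝ, ∑ i, x i ^ 2 - ∑ k, (∑ i, F k i * x i) ^ 2 =
        ‖orthoResidual b t (∑ i : Fin n, x i • e i)‖ ^ 2 := by
      intro x
      simp only [hFx]
      rw [← hres, norm_sum_smul_sq he']
    set Ω : Set (Fin n → ℝ) :=
      {ξ | ∀ k, |∑ i, F k i * (a i * ξ i) - (q k + B k / 2)| < (B k + η) / 2} with hΩ
    have hΩm : MeasurableSet Ω := by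
      refine IsOpen.measurableSet ?_
      rw [hΩ, Set.ofPred_forall]
      refine isOpen_iInter_of_finite fun k => isOpen_lt ?_ continuous_const
      fun_prop
    have hDΩ : ∀ ξ ∈ D, (fun i : Fin n => ξ i) ∈ Ω := by
      intro ξ hξ k
      obtain ⟨x, hx, hxb⟩ := hDb ξ hξ
      rw [hFx k fun i => a i * ξ i, ← Finset.sum_range fun i => (a i * ξ i) • e i]
      set y := ∑ i ∈ Finset.range n, (a i * ξ i) • e i with hy
      have hxy : ‖x - y‖ ≤ √(∑' i, a (i + n) ^ 2) := by
        refine le_of_tendsto ((hx.tendsto_sum_nat.sub_const y).norm) ?_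
        filter_upwards [eventually_ge_atTop n] with N hN
        rw [hy, Finset.sum_range_sub_sum_range hN]
        exact norm_sum_smul_le_sqrt_tail he hsum n _
          (fun i hi => (Finset.mem_filter.1 hi).2) (hD hξ)
      have h3 : |⟪b k, y⟫ - ⟪b k, x⟫| ≤ √(∑' i, a (i + n) ^ 2) := by
        rw [← inner_sub_right]
        refine (abs_real_inner_le_norm _ _).trans ?_
        rw [b.orthonormal.norm_eq_one, one_mul, norm_sub_rev]
        exact hxy
      have h4 := hxb k
      have h5 := abs_le.1 h3
      rw [abs_lt]
      constructor <;> linarith [h4.1, h4.2, h5.1, h5.2]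
    refine (measure_le_volume_of_subset π hπ n hD Ω hΩm hDΩ).trans ?_
    refine (volume_slabs_cube_le (fun i : Fin n => a i) (fun i => ha i) F (fun x => ?_) hκ0
      (fun k => q k + B k / 2) (fun k => B k + η) (fun k => by linarith [hB k]) ε _
      (hΩm.inter (MeasurableSet.univ_pi fun _ => measurableSet_Ioo)) (fun ξ hξ i => hξ.2 i trivial)
      (fun ξ hξ => hξ.1) fun ξ hξ => ?_).trans (ENNReal.ofReal_le_ofReal (Real.exp_le_exp.2 ?_))
    · have := hFF x
      have := sq_nonneg ‖orthoResidual b t (∑ i : Fin n, x i • e i)‖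
      linarith
    · rw [hFF fun i => a i * ξ i]
      set ζ : ℕ → ℝ := fun i => if h : i < n then ξ ⟨i, h⟩ else 0 with hζ
      have hζc : ζ ∈ cube := by
        intro i
        simp only [hζ]
        split_ifs with h
        · exact Set.Ioo_subset_Icc_self (hξ.2 ⟨i, h⟩ trivial)
        · simp
      have := ht2 n ζ hζc
      rw [Finset.sum_range] at this
      simpa [hζ] using this
    · have e1 : ∑ k : t, slabEntropy (κ * (B k + η) ^ 2) =
          ∑ k ∈ t, slabEntropy (κ * (B k + η) ^ 2) :=
        Finset.sum_coe_sort t fun k => slabEntropy (κ * (B k + η) ^ 2)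
      have e2 : ∑ i : Fin n, min 1 (κ * a i ^ 2) * (1 - ∑ k, F k i ^ 2) =
          ∑ i ∈ Finset.range n, min 1 (κ * a i ^ 2) * ‖orthoResidual b t (e i)‖ ^ 2 := by
        rw [Finset.sum_range]
        refine Finset.sum_congr rfl fun i _ => ?_
        rw [← hres, he.norm_eq_one, one_pow]
      rw [← Finset.sum_range fun i => slabEntropy (κ * a i ^ 2), e1, e2]
      have e3 := mul_le_mul_of_nonneg_left (ht1 n)
        (by have := Real.log_nonneg hκ; positivity : 0 ≤ (1 + Real.log κ) / 2)
      rw [hc]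
      linarith
  have hlim : Tendsto (fun ε => ENNReal.ofReal (Real.exp (C - S + c * ε)))
      (nhdsWithin 0 (Set.Ioi 0)) (nhds (ENNReal.ofReal (Real.exp (C - S)))) := by
    have : Continuous fun ε => ENNReal.ofReal (Real.exp (C - S + c * ε)) :=
      ENNReal.continuous_ofReal.comp (by fun_prop)
    have h := this.tendsto 0
    rw [mul_zero, add_zero] at h
    exact h.mono_left nhdsWithin_le_nhds
  exact ge_of_tendsto hlim (eventually_mem_nhdsWithin.mono fun ε hε => hmain ε hε)

open RealInnerProductSpace in
theorem hasSum_l2_sq (x : lp (fun _ : ℕ => ℝ) 2) : HasSum (fun i => x i ^ 2) (‖x‖ ^ 2) := by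
  have h := lp.hasSum_inner (𝕜 := ℝ) x x
  rw [real_inner_self_eq_norm_sq] at h
  simpa [sq] using h

theorem memlp_mul_iff {a x : ℕ → ℝ} : Memℓp (fun i => a i * x i) 2 ↔ x ∈ Ma a := by
  rw [memℓp_gen_iff (by simp)]
  simp [Ma, mul_pow]

theorem exists_l2_of_mem_Ma {a x : ℕ → ℝ} (hx : x ∈ Ma a) :
    ∃ X : lp (fun _ : ℕ => ℝ) 2, ∀ i, X i = a i * x i :=
  ⟨⟨_, memlp_mul_iff.2 hx⟩, fun _ => rfl⟩

theorem da_eq_norm {a x y : ℕ → ℝ} {X Y : lp (fun _ : ℕ => ℝ) 2} (hX : ∀ i, X i = a i * x i)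
    (hY : ∀ i, Y i = a i * y i) : da a x y = ‖X - Y‖ := by
  have h := hasSum_l2_sq (X - Y)
  have h' : (fun i => ((X - Y : lp (fun _ : ℕ => ℝ) 2) i) ^ 2) =
      fun i => a i ^ 2 * (x i - y i) ^ 2 := by
    funext i
    rw [lp.coeFn_sub, Pi.sub_apply, hX, hY]
    ring
  rw [h'] at h
  rw [da, h.tsum_eq, Real.sqrt_sq (norm_nonneg _)]

theorem cube_subset_Ma {a : ℕ → ℝ} (hsum : Summable fun i => a i ^ 2) : cube ⊆ Ma a := by
  intro x hx
  refine Summable.of_nonneg_of_le (fun i => by positivity) (fun i => ?_) hsum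
  exact mul_le_of_le_one_right (sq_nonneg _) (pow_le_one₀ (hx i).1 (hx i).2)

theorem cylSet_subset_cube {lo hi : ℕ → ℝ} (h : IsBCData lo hi) : cylSet lo hi ⊆ cube :=
  fun _ hx i => ⟨(h.1 i).trans (hx i).1, (hx i).2.trans (h.2.2.1 i)⟩

theorem mem_Ma_of_da_ne_zero {a x y : ℕ → ℝ} (hx : x ∈ Ma a) (h : da a x y ≠ 0) : y ∈ Ma a := by
  have hs : (x - y) ∈ Ma a := by
    by_contra hs
    have h0 : ∑' i, a i ^ 2 * (x i - y i) ^ 2 = 0 := tsum_eq_zero_of_not_summable hs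
    exact h (by rw [da, h0, Real.sqrt_zero])
  have h1 := (memlp_mul_iff.2 hx).sub (memlp_mul_iff.2 hs)
  refine memlp_mul_iff.1 ?_
  convert! h1 using 2 with i
  simp
  ring

theorem orthonormal_l2_single :
    Orthonormal ℝ fun i : ℕ => (lp.single 2 i (1 : ℝ) : lp (fun _ : ℕ => ℝ) 2) := by
  rw [orthonormal_iff_ite]
  intro i j
  rw [lp.inner_single_left]
  simp [lp.single_apply, Pi.single_apply]

theorem hasSum_l2_single (X : lp (fun _ : ℕ => ℝ) 2) :
    HasSum (fun i => X i • (lp.single 2 i (1 : ℝ) : lp (fun _ : ℕ => ℝ) 2)) X := by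
  have := lp.hasSum_single (p := 2) (by simp) X
  convert! this using 2 with i
  rw [← lp.single_smul]
  simp

open RealInnerProductSpace in
theorem inner_eq_zero_of_hasSum_sq {H ι σ : Type*} [NormedAddCommGroup H] [InnerProductSpace ℝ H]
    {b : ι → H} (hb : Orthonormal ℝ b) {j : σ → ι} (hj : Function.Injective j) {u : H}
    (hu : HasSum (fun k => ⟪b (j k), u⟫ ^ 2) (‖u‖ ^ 2)) {h : ι} (hh : h ∉ Set.range j) :
    ⟪b h, u⟫ = 0 := by
  classical
  have h1 : ‖u‖ ^ 2 ≤ ‖u‖ ^ 2 - ⟪b h, u⟫ ^ 2 := by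
    refine le_of_tendsto' hu fun T => ?_
    have h2 := hb.sum_inner_products_le (s := insert h (T.map ⟨j, hj⟩)) u
    rw [Finset.sum_insert, Finset.sum_map] at h2
    · simp only [Real.norm_eq_abs, sq_abs, Function.Embedding.coeFn_mk] at h2
      linarith
    · intro hmem
      obtain ⟨k, -, hk⟩ := Finset.mem_map.1 hmem
      exact hh ⟨k, hk⟩
  have h3 := sq_nonneg ⟪b h, u⟫
  exact pow_eq_zero_iff two_ne_zero |>.1 (le_antisymm (by linarith) h3)

open RealInnerProductSpace in
theorem inner_eq_of_isometry {X H H' : Type*} [NormedAddCommGroup H] [InnerProductSpace ℝ H]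
    [NormedAddCommGroup H'] [InnerProductSpace ℝ H'] {U : X → H} {V : X → H'}
    (h : ∀ x y, ‖U x - U y‖ = ‖V x - V y‖) (x y z : X) :
    ⟪U x - U z, U y - U z⟫ = ⟪V x - V z, V y - V z⟫ := by
  rw [real_inner_eq_norm_mul_self_add_norm_mul_self_sub_norm_sub_mul_self_div_two,
    real_inner_eq_norm_mul_self_add_norm_mul_self_sub_norm_sub_mul_self_div_two]
  simp only [sub_sub_sub_cancel_right, h]

theorem tendsto_exp_slabEntropy_sub {v w : ℝ} (hv : 0 < v) (hw : 0 ≤ w) :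
    Tendsto (fun κ => Real.exp (slabEntropy (κ * (v * w) ^ 2) - slabEntropy (κ * v ^ 2))) atTop
      (nhds w) := by
  have hG : ∀ {z : ℝ}, 1 ≤ z → slabEntropy z = (1 + Real.log z) / 2 := fun hz => by
    rw [slabEntropy, min_eq_right hz, max_eq_left hz]
  have hev : ∀ {u : ℝ}, 0 < u → ∀ᶠ κ : ℝ in atTop, 1 ≤ κ * u ^ 2 := fun hu =>
    (tendsto_id.atTop_mul_const (by positivity)).eventually_ge_atTop 1
  rcases hw.eq_or_lt with rfl | hw
  · simp only [mul_zero, ne_eq, OfNat.ofNat_ne_zero, not_false_eq_true, zero_pow, slabEntropy_zero,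
      zero_sub]
    refine Real.tendsto_exp_neg_atTop_nhds_zero.comp ?_
    have h1 : Tendsto (fun κ => (1 + Real.log (κ * v ^ 2)) / 2) atTop atTop := by
      refine Tendsto.atTop_div_const two_pos (tendsto_atTop_add_const_left _ _ ?_)
      exact Real.tendsto_log_atTop.comp (tendsto_id.atTop_mul_const (by positivity))
    refine h1.congr' ?_
    filter_upwards [hev hv] with κ hκ
    rw [hG hκ]
  · refine tendsto_const_nhds.congr' ?_
    filter_upwards [hev hv, hev (mul_pos hv hw), eventually_gt_atTop 0] with κ h1 h2 h3
    rw [hG h1, hG h2, Real.log_mul h3.ne' (by positivity), Real.log_mul h3.ne' (by positivity),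
      Real.log_pow, Real.log_pow, Real.log_mul hv.ne' hw.ne']
    have : (1 + (Real.log κ + (2 : ℕ) * (Real.log v + Real.log w))) / 2 -
        (1 + (Real.log κ + (2 : ℕ) * Real.log v)) / 2 = Real.log w := by
      push_cast; ring
    rw [this, Real.exp_log hw]

open RealInnerProductSpace MeasureTheory in
theorem measure_isometric_image_le (a : ℕ → ℝ) (ha : ∀ i, 0 < a i)
    (hsum : Summable fun i => a i ^ 2) (π : Measure (ℕ → ℝ))
    (hπ : ∀ lo hi : ℕ → ℝ, IsBCData lo hi → π (cylSet lo hi) = ENNReal.ofReal (bcVol lo hi))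
    {lo hi : ℕ → ℝ} (hJ : IsBCData lo hi) {f : (ℕ → ℝ) → ℕ → ℝ} (hf : IsIsomOn a f (cylSet lo hi))
    {κ : ℝ} (hκ : 1 ≤ κ) :
    π (f '' cylSet lo hi ∩ cube) ≤ ENNReal.ofReal (Real.exp
      (∑' i, slabEntropy (κ * (a i * (hi i - lo i)) ^ 2) - ∑' i, slabEntropy (κ * a i ^ 2))) := by
  rcases (f '' cylSet lo hi ∩ cube).eq_empty_or_nonempty with h | ⟨_, ⟨x₀, hx₀, rfl⟩, hfx₀⟩
  · rw [h, measure_empty]; exact zero_le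
  have hJM : cylSet lo hi ⊆ Ma a := (cylSet_subset_cube hJ).trans (cube_subset_Ma hsum)
  have hfM : ∀ x ∈ cylSet lo hi, f x ∈ Ma a := by
    intro x hx
    by_cases hxx : x = x₀
    · rw [hxx]; exact cube_subset_Ma hsum hfx₀
    refine mem_Ma_of_da_ne_zero (cube_subset_Ma hsum hfx₀) ?_
    rw [hf _ hx₀ _ hx]
    obtain ⟨X, hX⟩ := exists_l2_of_mem_Ma (hJM hx)
    obtain ⟨X₀, hX₀⟩ := exists_l2_of_mem_Ma (hJM hx₀)
    rw [da_eq_norm hX₀ hX]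
    intro h0
    have h1 := sub_eq_zero.1 (norm_eq_zero.1 h0)
    refine hxx (funext fun i => ?_)
    have h2 := hX i
    rw [← h1, hX₀] at h2
    exact (mul_left_cancel₀ (ha i).ne' h2).symm
  choose U hU using fun x : cylSet lo hi => exists_l2_of_mem_Ma (hfM x x.2)
  choose V hV using fun x : cylSet lo hi => exists_l2_of_mem_Ma (hJM x.2)
  have hUV : ∀ x y, ‖U x - U y‖ = ‖V x - V y‖ := fun x y => by
    rw [← da_eq_norm (hU x) (hU y), ← da_eq_norm (hV x) (hV y), hf _ x.2 _ y.2]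
  have hin := inner_eq_of_isometry hUV
  set e : ℕ → lp (fun _ : ℕ => ℝ) 2 := fun i => lp.single 2 i (1 : ℝ) with he
  have heo : Orthonormal ℝ e := orthonormal_l2_single
  have hinner : ∀ k (Z : lp (fun _ : ℕ => ℝ) 2), ⟪e k, Z⟫ = Z k := fun k Z => by
    rw [he, lp.inner_single_left]; simp
  set p₀ : cylSet lo hi := ⟨lo, fun i => ⟨le_rfl, hJ.2.1 i⟩⟩ with hp₀
  set p : ℕ → cylSet lo hi := fun k => ⟨Function.update lo k (hi k), fun i => by
    by_cases hik : i = k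
    · subst hik; simp [hJ.2.1 i]
    · simp [hik, hJ.2.1 i]⟩ with hp
  set L : ℕ → ℝ := fun k => a k * (hi k - lo k) with hL
  have hVp : ∀ k, V (p k) - V p₀ = L k • e k := by
    intro k
    ext i
    rw [lp.coeFn_sub, Pi.sub_apply, hV, hV, lp.coeFn_smul, Pi.smul_apply]
    by_cases hik : i = k
    · subst hik; simp [hp, hp₀, he, hL]; ring
    · simp [hp, hp₀, he, hik]
  set S : Set ℕ := {k | lo k < hi k} with hS
  have hL0 : ∀ k : S, 0 < L k := fun k => mul_pos (ha k) (sub_pos.2 k.2)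
  set g : S → lp (fun _ : ℕ => ℝ) 2 := fun k => (L k)⁻¹ • (U (p k) - U p₀) with hg
  have hgo : Orthonormal ℝ g := by
    classical
    rw [orthonormal_iff_ite]
    intro i j
    have h1 := (hL0 i).ne'
    have h2 := (hL0 j).ne'
    rw [hg, inner_smul_left, inner_smul_right, hin, hVp, hVp, inner_smul_left, inner_smul_right,
      orthonormal_iff_ite.1 heo]
    simp only [conj_trivial, Subtype.ext_iff]
    split_ifs with hij
    · rw [mul_one, hij]; field_simp
    · simp
  have hgU : ∀ (k : S) x, ⟪g k, U x - U p₀⟫ = a k * ((x : ℕ → ℝ) k - lo k) := by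
    intro k x
    have h1 := (hL0 k).ne'
    rw [hg, inner_smul_left, hin, hVp, inner_smul_left, hinner, lp.coeFn_sub, Pi.sub_apply, hV, hV]
    simp only [conj_trivial]
    rw [inv_mul_cancel_left₀ h1]
    ring
  obtain ⟨w, b, hsw, hb⟩ := hgo.toSubtypeRange.exists_hilbertBasis_extension
  set j : S → w := fun k => ⟨g k, hsw ⟨k, rfl⟩⟩ with hj
  have hjinj : Function.Injective j := fun k k' hkk => by
    have h1 : g k = g k' := congrArg Subtype.val hkk
    by_contra hne
    have h2 := hgo.inner_eq_zero hne
    rw [h1, real_inner_self_eq_norm_sq, hgo.norm_eq_one] at h2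
    norm_num at h2
  have hbj : ∀ k, b (j k) = g k := fun k => by rw [hb]
  have hsq : ∀ x, HasSum (fun k => ⟪b (j k), U x - U p₀⟫ ^ 2) (‖U x - U p₀‖ ^ 2) := by
    intro x
    simp only [hbj, hgU, hUV]
    have h1 := hasSum_l2_sq (V x - V p₀)
    have h2 : ∀ i, (V x - V p₀ : lp (fun _ : ℕ => ℝ) 2) i = a i * ((x : ℕ → ℝ) i - lo i) :=
      fun i => by rw [lp.coeFn_sub, Pi.sub_apply, hV, hV]; ring
    simp only [h2] at h1
    refine (hasSum_subtype_iff_of_support_subset (s := S) fun i hi' => ?_).2 h1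
    by_contra hiS
    have h3 : hi i ≤ lo i := not_lt.1 hiS
    have h4 := x.2 i
    exact hi' (by simp [le_antisymm (h4.2.trans h3) h4.1])
  set B : w → ℝ := Function.extend j (fun k => L k) 0 with hB
  have hBj : ∀ k, B (j k) = L k := fun k => hjinj.extend_apply _ _ _
  have hBn : ∀ h, h ∉ Set.range j → B h = 0 := fun h hh =>
    Function.extend_apply' _ _ _ hh
  have hB0 : ∀ h, 0 ≤ B h := by
    intro h
    by_cases hh : h ∈ Set.range j
    · obtain ⟨k, rfl⟩ := hh
      rw [hBj]; exact (hL0 k).le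
    · rw [hBn h hh]
  have hsL : Summable fun i => L i ^ 2 := by
    refine Summable.of_nonneg_of_le (fun i => sq_nonneg _) (fun i => ?_) hsum
    have h1 := hJ.1 i
    have h2 := hJ.2.1 i
    have h3 := hJ.2.2.1 i
    rw [hL, mul_pow]
    exact mul_le_of_le_one_right (sq_nonneg _) (pow_le_one₀ (by linarith) (by linarith))
  have hsG : HasSum (fun h => slabEntropy (κ * B h ^ 2)) (∑' i, slabEntropy (κ * L i ^ 2)) := by
    have h1 := (summable_slabEntropy (f := fun i => κ * L i ^ 2) (fun i => by positivity)
      (hsL.mul_left κ)).hasSum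
    have h2 : HasSum (fun k : S => slabEntropy (κ * L k ^ 2)) (∑' i, slabEntropy (κ * L i ^ 2)) := by
      refine (hasSum_subtype_iff_of_support_subset (s := S) fun i hi' => ?_).2 h1
      by_contra hiS
      have h3 : hi i = lo i := le_antisymm (not_lt.1 hiS) (hJ.2.1 i)
      exact hi' (by simp [hL, h3, slabEntropy_zero])
    rw [← hasSum_extend_zero hjinj] at h2
    convert! h2 using 1
    funext h
    by_cases hh : h ∈ Set.range j
    · obtain ⟨k, rfl⟩ := hh
      rw [hjinj.extend_apply, hBj]
    · rw [Function.extend_apply' _ _ _ hh, hBn h hh]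
      simp [slabEntropy_zero]
  refine measure_le_of_hilbertBasis a ha hsum π hπ heo b (fun h => ⟪b h, U p₀⟫) B hB0 hκ _
    (fun t => sum_le_hasSum t (fun h _ => slabEntropy_nonneg (by positivity)) hsG)
    Set.inter_subset_right ?_
  rintro _ ⟨⟨x, hx, rfl⟩, -⟩
  refine ⟨U ⟨x, hx⟩, ?_, fun h => ?_⟩
  · have := hasSum_l2_single (U ⟨x, hx⟩)
    simp only [hU] at this
    exact this
  have h1 : ⟪b h, U ⟨x, hx⟩⟫ = ⟪b h, U p₀⟫ + ⟪b h, U ⟨x, hx⟩ - U p₀⟫ := by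
    rw [inner_sub_right]; ring
  rw [h1]
  by_cases hh : h ∈ Set.range j
  · obtain ⟨k, rfl⟩ := hh
    rw [hBj]
    have h2 : ⟪b (j k), U ⟨x, hx⟩ - U p₀⟫ = a k * (x k - lo k) := by rw [hbj, hgU]
    have h3 := hx k
    have h4 := ha k
    rw [h2]
    constructor
    · have : 0 ≤ a k * (x k - lo k) := mul_nonneg h4.le (sub_nonneg.2 h3.1)
      linarith
    · have : a k * (x k - lo k) ≤ L k := mul_le_mul_of_nonneg_left (by linarith [h3.2]) h4.le
      linarith
  · rw [inner_eq_zero_of_hasSum_sq b.orthonormal hjinj (hsq ⟨x, hx⟩) hh, hBn h hh]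
    simp

open MeasureTheory in
theorem measure_inter_cube_le_of_isCylVol (a : ℕ → ℝ) (ha : ∀ i, 0 < a i)
    (hsum : Summable fun i => a i ^ 2) (π : Measure (ℕ → ℝ))
    (hπ : ∀ lo hi : ℕ → ℝ, IsBCData lo hi → π (cylSet lo hi) = ENNReal.ofReal (bcVol lo hi))
    {K : Set (ℕ → ℝ)} {v : ℝ} (hK : IsCylVol a K v) : π (K ∩ cube) ≤ ENNReal.ofReal v := by
  obtain ⟨lo, hi, hJ, rfl, f, hf, rfl⟩ := hK
  set N : Finset ℕ := hJ.2.2.2.toFinset with hN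
  have hN1 : ∀ i ∉ N, hi i - lo i = 1 := by
    intro i hi'
    simp only [hN, Set.Finite.mem_toFinset, Set.mem_ofPred_eq, not_not] at hi'
    rw [hi'.1, hi'.2, sub_zero]
  have hvol : bcVol lo hi = ∏ i ∈ N, (hi i - lo i) := by
    refine finprod_eq_prod_of_mulSupport_subset _ fun i hi' => ?_
    by_contra h
    exact hi' (hN1 i h)
  have hw0 : ∀ i, 0 ≤ hi i - lo i := fun i => sub_nonneg.2 (hJ.2.1 i)
  have hbound : ∀ κ : ℝ, 1 ≤ κ → π (f '' cylSet lo hi ∩ cube) ≤ ENNReal.ofReal (∏ i ∈ N,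
      Real.exp (slabEntropy (κ * (a i * (hi i - lo i)) ^ 2) - slabEntropy (κ * a i ^ 2))) := by
    intro κ hκ
    refine (measure_isometric_image_le a ha hsum π hπ hJ hf hκ).trans_eq ?_
    have hs1 : Summable fun i => slabEntropy (κ * a i ^ 2) :=
      summable_slabEntropy (fun i => by positivity) (hsum.mul_left κ)
    have hs2 : Summable fun i => slabEntropy (κ * (a i * (hi i - lo i)) ^ 2) := by
      refine summable_slabEntropy (fun i => by positivity) (Summable.mul_left κ ?_)
      refine Summable.of_nonneg_of_le (fun i => sq_nonneg _) (fun i => ?_) hsum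
      rw [mul_pow]
      refine mul_le_of_le_one_right (sq_nonneg _) (pow_le_one₀ (hw0 i) ?_)
      linarith [hJ.1 i, hJ.2.2.1 i]
    rw [← hs2.tsum_sub hs1, ← Real.exp_sum, tsum_eq_sum]
    intro i hi'
    rw [hN1 i hi', mul_one, sub_self]
  have hlim : Tendsto (fun κ => ENNReal.ofReal (∏ i ∈ N,
      Real.exp (slabEntropy (κ * (a i * (hi i - lo i)) ^ 2) - slabEntropy (κ * a i ^ 2)))) atTop
      (nhds (ENNReal.ofReal (bcVol lo hi))) := by
    rw [hvol]
    exact (ENNReal.continuous_ofReal.tendsto _).comp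
      (tendsto_finsetProd _ fun i _ => tendsto_exp_slabEntropy_sub (ha i) (hw0 i))
  exact ge_of_tendsto hlim ((eventually_ge_atTop 1).mono hbound)

open MeasureTheory in
theorem measure_le_muA (a : ℕ → ℝ) (ha : ∀ i, 0 < a i)
    (hsum : Summable fun i => a i ^ 2) (π : Measure (ℕ → ℝ))
    (hπ : ∀ lo hi : ℕ → ℝ, IsBCData lo hi → π (cylSet lo hi) = ENNReal.ofReal (bcVol lo hi))
    {E : Set (ℕ → ℝ)} (hE : E ⊆ cube) : π E ≤ muA a E := by
  refine le_trans ?_ (le_iSup₂ (f := fun (δ : ℝ) (_ : 0 < δ) => preMu a δ E) 1 one_pos)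
  refine le_sInf ?_
  rintro _ ⟨K, v, hK, -, hEK, rfl⟩
  calc π E ≤ π (⋃ n, K n ∩ cube) := measure_mono fun x hx => by
        obtain ⟨n, hn⟩ := Set.mem_iUnion.1 (hEK hx)
        exact Set.mem_iUnion.2 ⟨n, hn, hE hx⟩
    _ ≤ ∑' n, π (K n ∩ cube) := measure_iUnion_le _
    _ ≤ ∑' n, ENNReal.ofReal (v n) := ENNReal.tsum_le_tsum fun n =>
        measure_inter_cube_le_of_isCylVol a ha hsum π hπ (hK n)

theorem preMu_le_tsum {ι : Type*} [Countable ι] {a : ℕ → ℝ} {δ : ℝ} {E : Set (ℕ → ℝ)}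
    (K : ι → Set (ℕ → ℝ)) (v : ι → ℝ) (hK : ∀ k, IsCylVol a (K k) (v k))
    (hd : ∀ k, daDiam a (K k) < δ) (hE : E ⊆ ⋃ k, K k) {K₀ : Set (ℕ → ℝ)}
    (hK₀ : IsCylVol a K₀ 0) (hd₀ : daDiam a K₀ < δ) :
    preMu a δ E ≤ ∑' k, ENNReal.ofReal (v k) := by
  obtain ⟨g, hg⟩ := exists_injective_nat ι
  have hex : ∀ n, (∃ k, g k = n) ∨ n ∉ Set.range g := fun n => by
    by_cases h : n ∈ Set.range g
    · exact Or.inl h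
    · exact Or.inr h
  refine sInf_le ⟨Function.extend g K fun _ => K₀, Function.extend g v 0, fun n => ?_, fun n => ?_,
    fun x hx => ?_, ?_⟩
  · rcases hex n with ⟨k, rfl⟩ | h
    · rw [hg.extend_apply, hg.extend_apply]; exact hK k
    · rw [Function.extend_apply' _ _ _ h, Function.extend_apply' _ _ _ h]; exact hK₀
  · rcases hex n with ⟨k, rfl⟩ | h
    · rw [hg.extend_apply]; exact hd k
    · rw [Function.extend_apply' _ _ _ h]; exact hd₀
  · obtain ⟨k, hk⟩ := Set.mem_iUnion.1 (hE hx)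
    exact Set.mem_iUnion.2 ⟨g k, by rw [hg.extend_apply]; exact hk⟩
  · rw [← tsum_extend_zero hg]
    refine tsum_congr fun n => ?_
    rcases hex n with ⟨k, rfl⟩ | h
    · rw [hg.extend_apply, hg.extend_apply]
    · rw [Function.extend_apply' _ _ _ h, Function.extend_apply' _ _ _ h]; simp

theorem IsBCData.isCylVol (a : ℕ → ℝ) {lo hi : ℕ → ℝ} (h : IsBCData lo hi) :
    IsCylVol a (cylSet lo hi) (bcVol lo hi) :=
  ⟨lo, hi, h, rfl, id, fun _ _ _ _ => rfl, Set.image_id _⟩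

theorem bcVol_eq_zero {lo hi : ℕ → ℝ} (h : IsBCData lo hi) {i : ℕ} (hi' : lo i = hi i) :
    bcVol lo hi = 0 := by
  refine finprod_eq_zero _ i (by rw [hi', sub_self]) (h.2.2.2.subset fun k hk => ?_)
  rintro ⟨h1, h2⟩
  exact hk (by simp only [h1, h2, sub_zero])

theorem daDiam_cylSet_le {a lo hi : ℕ → ℝ} (hsum : Summable fun i => a i ^ 2)
    (h : IsBCData lo hi) (N : ℕ) (hN : ∀ i < N, hi i - lo i ≤ (1 / 2) ^ N) :
    daDiam a (cylSet lo hi) ≤ √(∑' i, a i ^ 2 * if i < N then (1 / 4 : ℝ) ^ N else 1) := by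
  refine Real.sSup_le ?_ (Real.sqrt_nonneg _)
  rintro _ ⟨x, hx, y, hy, rfl⟩
  have hle : ∀ i, a i ^ 2 * (x i - y i) ^ 2 ≤ a i ^ 2 * if i < N then (1 / 4 : ℝ) ^ N else 1 := by
    intro i
    refine mul_le_mul_of_nonneg_left ?_ (sq_nonneg _)
    have h1 := hx i
    have h2 := hy i
    have h3 : |x i - y i| ≤ hi i - lo i := abs_le.2 ⟨by linarith [h1.1, h2.2], by
      linarith [h1.2, h2.1]⟩
    rw [← sq_abs]
    split_ifs with hi'
    · have : (1 / 4 : ℝ) ^ N = ((1 / 2) ^ N) ^ 2 := by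
        rw [← pow_mul, mul_comm, pow_mul]; norm_num
      rw [this]
      exact pow_le_pow_left₀ (abs_nonneg _) (h3.trans (hN i hi')) 2
    · refine pow_le_one₀ (abs_nonneg _) (h3.trans ?_)
      linarith [h.1 i, h.2.2.1 i]
  have hs : Summable fun i => a i ^ 2 * if i < N then (1 / 4 : ℝ) ^ N else 1 := by
    refine Summable.of_nonneg_of_le (fun i => by positivity) (fun i => ?_) hsum
    refine mul_le_of_le_one_right (sq_nonneg _) ?_
    split_ifs
    · exact pow_le_one₀ (by norm_num) (by norm_num)
    · exact le_rfl
  exact Real.sqrt_le_sqrt (Summable.tsum_le_tsum hle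
    (Summable.of_nonneg_of_le (fun i => by positivity) hle hs) hs)

theorem tendsto_sqrt_tsum_dyadic {a : ℕ → ℝ} (hsum : Summable fun i => a i ^ 2) :
    Tendsto (fun N : ℕ => √(∑' i, a i ^ 2 * if i < N then (1 / 4 : ℝ) ^ N else 1)) atTop
      (nhds 0) := by
  rw [← Real.sqrt_zero]
  refine Tendsto.sqrt ?_
  have h0 : ∑' _ : ℕ, (0 : ℝ) = 0 := tsum_zero
  rw [← h0]
  refine tendsto_tsum_of_dominated_convergence hsum (fun i => ?_) (Eventually.of_forall fun N i => ?_)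
  · have h1 : Tendsto (fun N : ℕ => a i ^ 2 * (1 / 4 : ℝ) ^ N) atTop (nhds 0) := by
      simpa using (tendsto_pow_atTop_nhds_zero_of_lt_one (r := (1 / 4 : ℝ)) (by norm_num)
        (by norm_num)).const_mul (a i ^ 2)
    refine h1.congr' ?_
    filter_upwards [eventually_gt_atTop i] with N hN
    rw [if_pos hN]
  · rw [Real.norm_of_nonneg (by positivity)]
    refine mul_le_of_le_one_right (sq_nonneg _) ?_
    split_ifs
    · exact pow_le_one₀ (by norm_num) (by norm_num)
    · exact le_rfl

/-- The dyadic cell of level `N` in the cube around a point. -/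
def dyadicCell (N : ℕ) (ξ : ℕ → ℝ) : Set (ℕ → ℝ) :=
  {η | η ∈ cube ∧ ∀ i < N, ⌊2 ^ N * η i⌋ = ⌊2 ^ N * ξ i⌋}

/-- The lower endpoints of the closed dyadic box of level `N` around a point. -/
def dyadicLo (N : ℕ) (ξ : ℕ → ℝ) (i : ℕ) : ℝ := if i < N then ⌊2 ^ N * ξ i⌋ / 2 ^ N else 0

/-- The upper endpoints of the closed dyadic box of level `N` around a point. -/
def dyadicHi (N : ℕ) (ξ : ℕ → ℝ) (i : ℕ) : ℝ :=
  if i < N then min ((⌊2 ^ N * ξ i⌋ + 1) / 2 ^ N) 1 else 1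

theorem isBCData_dyadic (N : ℕ) {ξ : ℕ → ℝ} (hξ : ξ ∈ cube) :
    IsBCData (dyadicLo N ξ) (dyadicHi N ξ) := by
  have h2 : (0 : ℝ) < 2 ^ N := by positivity
  refine ⟨fun i => ?_, fun i => ?_, fun i => ?_, (Set.finite_lt_nat N).subset fun i hi => ?_⟩
  · unfold dyadicLo
    split_ifs
    · have : 0 ≤ ⌊2 ^ N * ξ i⌋ := Int.floor_nonneg.2 (mul_nonneg h2.le (hξ i).1)
      positivity
    · exact le_rfl
  · unfold dyadicLo dyadicHi
    split_ifs
    · refine le_min (by gcongr; linarith) ?_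
      rw [div_le_one h2]
      exact (Int.floor_le _).trans (mul_le_of_le_one_right h2.le (hξ i).2)
    · exact zero_le_one
  · unfold dyadicHi
    split_ifs
    · exact min_le_right _ _
    · exact le_rfl
  · by_contra h
    simp only [Set.mem_ofPred_eq] at h
    simp [dyadicLo, dyadicHi, h] at hi

theorem dyadicHi_sub_dyadicLo_le (N : ℕ) (ξ : ℕ → ℝ) {i : ℕ} (hi : i < N) :
    dyadicHi N ξ i - dyadicLo N ξ i ≤ (1 / 2) ^ N := by
  unfold dyadicLo dyadicHi
  rw [if_pos hi, if_pos hi]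
  have h1 := min_le_left (((⌊2 ^ N * ξ i⌋ : ℝ) + 1) / 2 ^ N) 1
  have h2 : ((⌊2 ^ N * ξ i⌋ : ℝ) + 1) / 2 ^ N = ⌊2 ^ N * ξ i⌋ / 2 ^ N + (1 / 2) ^ N := by
    rw [add_div, one_div_pow]
  linarith

theorem mem_cylSet_dyadic {N : ℕ} {ξ η : ℕ → ℝ} (hη : η ∈ dyadicCell N ξ) :
    η ∈ cylSet (dyadicLo N ξ) (dyadicHi N ξ) := by
  have h2 : (0 : ℝ) < 2 ^ N := by positivity
  intro i
  unfold dyadicLo dyadicHi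
  split_ifs with hi
  · rw [← hη.2 i hi]
    refine ⟨?_, le_min ?_ (hη.1 i).2⟩
    · rw [div_le_iff₀ h2, mul_comm]; exact Int.floor_le _
    · rw [le_div_iff₀ h2, mul_comm]; exact (Int.lt_floor_add_one _).le
  · exact hη.1 i

theorem measurableSet_cylSet (lo hi : ℕ → ℝ) : MeasurableSet (cylSet lo hi) := by
  have : cylSet lo hi = Set.univ.pi fun i => Set.Icc (lo i) (hi i) := by
    ext x
    simp only [cylSet, Set.mem_ofPred_eq, Set.mem_pi, Set.mem_univ, true_imp_iff]
  rw [this]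
  exact MeasurableSet.univ_pi fun _ => measurableSet_Icc

theorem measurableSet_cube : MeasurableSet cube := measurableSet_cylSet (fun _ => 0) fun _ => 1

theorem measurableSet_dyadicCell (N : ℕ) (ξ : ℕ → ℝ) : MeasurableSet (dyadicCell N ξ) := by
  have : dyadicCell N ξ = cube ∩ ⋂ i, ⋂ (_ : i < N), {η | ⌊2 ^ N * η i⌋ = ⌊2 ^ N * ξ i⌋} := by
    ext η; simp [dyadicCell]
  rw [this]
  refine measurableSet_cube.inter (MeasurableSet.iInter fun i => MeasurableSet.iInter fun _ => ?_)
  have hm : Measurable fun η : ℕ → ℝ => ⌊2 ^ N * η i⌋ :=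
    Int.measurable_floor.comp ((measurable_pi_apply i).const_mul _)
  exact hm (measurableSet_singleton _)

open MeasureTheory in
theorem bcVol_dyadic_le (π : Measure (ℕ → ℝ))
    (hπ : ∀ lo hi : ℕ → ℝ, IsBCData lo hi → π (cylSet lo hi) = ENNReal.ofReal (bcVol lo hi))
    (N : ℕ) {ξ : ℕ → ℝ} (hξ : ξ ∈ cube) :
    ENNReal.ofReal (bcVol (dyadicLo N ξ) (dyadicHi N ξ)) ≤ π (dyadicCell N ξ) := by
  have hbc := isBCData_dyadic N hξ
  have h2 : (0 : ℝ) < 2 ^ N := by positivity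
  rw [← hπ _ _ hbc]
  set F : ℕ → Set (ℕ → ℝ) := fun i =>
    cylSet (Function.update (dyadicLo N ξ) i (dyadicHi N ξ i)) (dyadicHi N ξ)
  have hF : ∀ i, π (F i) = 0 := by
    intro i
    have hbc' : IsBCData (Function.update (dyadicLo N ξ) i (dyadicHi N ξ i)) (dyadicHi N ξ) := by
      refine ⟨fun k => ?_, fun k => ?_, hbc.2.2.1, (hbc.2.2.2.union (Set.finite_singleton i)).subset
        fun k hk => ?_⟩
      · by_cases hki : k = i
        · subst hki; simpa using (hbc.1 k).trans (hbc.2.1 k)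
        · simpa [hki] using hbc.1 k
      · by_cases hki : k = i
        · subst hki; simp
        · simpa [hki] using hbc.2.1 k
      · by_cases hki : k = i
        · exact Or.inr hki
        · left
          simpa [hki] using hk
    rw [hπ _ _ hbc', bcVol_eq_zero hbc' (i := i) (by simp), ENNReal.ofReal_zero]
  have hsub : cylSet (dyadicLo N ξ) (dyadicHi N ξ) ⊆ dyadicCell N ξ ∪ ⋃ i, F i := by
    intro x hx
    by_cases h : ∃ i < N, x i = dyadicHi N ξ i
    · obtain ⟨i, -, hi⟩ := h
      refine Or.inr (Set.mem_iUnion.2 ⟨i, fun k => ?_⟩)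
      by_cases hki : k = i
      · subst hki; simp [hi]
      · simpa [hki] using hx k
    · push Not at h
      refine Or.inl ⟨cylSet_subset_cube hbc hx, fun i hi => ?_⟩
      have h3 := hx i
      have h4 := lt_of_le_of_ne h3.2 (h i hi)
      have h5 := h3.1
      simp only [dyadicLo, dyadicHi, if_pos hi] at h4 h5
      rw [Int.floor_eq_iff]
      constructor
      · rw [div_le_iff₀ h2] at h5; linarith
      · have := h4.trans_le (min_le_left _ _)
        rw [lt_div_iff₀ h2] at this; linarith
  refine (measure_mono hsub).trans ((measure_union_le _ _).trans_eq ?_)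
  rw [measure_iUnion_null hF, add_zero]

theorem exists_dyadicCell_subset {O : Set (ℕ → ℝ)} (hO : IsOpen O) {ξ : ℕ → ℝ} (hξ : ξ ∈ O)
    (N₀ : ℕ) : ∃ N ≥ N₀, dyadicCell N ξ ⊆ O := by
  obtain ⟨I, u, hu, hsub⟩ := isOpen_pi_iff.1 hO ξ hξ
  have hev : ∀ᶠ N in atTop, ∀ i ∈ I, ∀ η ∈ dyadicCell N ξ, η i ∈ u i := by
    rw [eventually_all_finset]
    intro i hi
    obtain ⟨r, hr, hball⟩ := Metric.isOpen_iff.1 (hu i hi).1 _ (hu i hi).2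
    have h1 : ∀ᶠ N : ℕ in atTop, (1 / 2 : ℝ) ^ N < r :=
      (tendsto_pow_atTop_nhds_zero_of_lt_one (by norm_num) (by norm_num)).eventually_lt_const hr
    filter_upwards [h1, eventually_gt_atTop i] with N hN hiN η hη
    refine hball ?_
    rw [Metric.mem_ball, Real.dist_eq]
    refine lt_of_le_of_lt ?_ hN
    have h2 : (0 : ℝ) < 2 ^ N := by positivity
    have h3 := Int.abs_sub_lt_one_of_floor_eq_floor (hη.2 i hiN)
    rw [← mul_sub, abs_mul, abs_of_pos h2] at h3
    rw [one_div_pow, le_div_iff₀ h2]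
    linarith
  obtain ⟨N, h1, h2⟩ := ((eventually_ge_atTop N₀).and hev).exists
  exact ⟨N, h1, fun η hη => hsub fun i hi => h2 i hi η hη⟩

theorem dyadicCell_eq_of_mem {M N : ℕ} (hMN : M ≤ N) {ξ η : ℕ → ℝ} (hη : η ∈ dyadicCell N ξ) :
    dyadicCell M η = dyadicCell M ξ := by
  have key : ∀ i < M, ⌊2 ^ M * η i⌋ = ⌊2 ^ M * ξ i⌋ := by
    intro i hi
    have h1 := hη.2 i (hi.trans_le hMN)
    have h2 : ∀ x : ℝ, ⌊2 ^ M * x⌋ = ⌊2 ^ N * x⌋ / 2 ^ (N - M) := by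
      intro x
      have h3 : (2 : ℝ) ^ M * x = 2 ^ N * x / ((2 ^ (N - M) : ℕ) : ℝ) := by
        have : (2 : ℝ) ^ N = 2 ^ M * 2 ^ (N - M) := by rw [← pow_add, Nat.add_sub_cancel' hMN]
        rw [this]
        push_cast
        field_simp
      rw [h3, Int.floor_div_natCast]
      push_cast
      rfl
    rw [h2, h2, h1]
  ext ζ
  exact and_congr_right fun _ => forall₂_congr fun i hi => by rw [key i hi]

open MeasureTheory in
theorem preMu_le_of_isOpen (a : ℕ → ℝ) (hsum : Summable fun i => a i ^ 2) (π : Measure (ℕ → ℝ))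
    (hπ : ∀ lo hi : ℕ → ℝ, IsBCData lo hi → π (cylSet lo hi) = ENNReal.ofReal (bcVol lo hi))
    {O : Set (ℕ → ℝ)} (hO : IsOpen O) {δ : ℝ} (hδ : 0 < δ) : preMu a δ (O ∩ cube) ≤ π (O ∩ cube) := by
  classical
  obtain ⟨N₀, hN₀⟩ := eventually_atTop.1
    ((tendsto_sqrt_tsum_dyadic hsum).eventually_lt_const hδ)
  have hdiam : ∀ {lo hi : ℕ → ℝ}, IsBCData lo hi → ∀ N > N₀,
      (∀ i < N, hi i - lo i ≤ (1 / 2) ^ N) → daDiam a (cylSet lo hi) < δ :=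
    fun h N hN hw => (daDiam_cylSet_le hsum h N hw).trans_lt (hN₀ N (le_of_lt hN))
  have hpad : IsBCData (fun _ => 0) fun i => if i < N₀ + 1 then 0 else 1 := by
    refine ⟨fun _ => le_rfl, fun i => ?_, fun i => ?_,
      (Set.finite_lt_nat (N₀ + 1)).subset fun i hi => ?_⟩
    · dsimp only; split_ifs <;> norm_num
    · dsimp only; split_ifs <;> norm_num
    · by_contra h
      exact hi ⟨rfl, if_neg h⟩
  have hex : ∀ ξ : ↥(O ∩ cube), ∃ N, N₀ < N ∧ dyadicCell N ξ ⊆ O :=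
    fun ξ => exists_dyadicCell_subset hO ξ.2.1 (N₀ + 1)
  let lev : ↥(O ∩ cube) → ℕ := fun ξ => Nat.find (hex ξ)
  have hlev₁ : ∀ ξ, N₀ < lev ξ := fun ξ => (Nat.find_spec (hex ξ)).1
  have hlev₂ : ∀ ξ, dyadicCell (lev ξ) ξ ⊆ O := fun ξ => (Nat.find_spec (hex ξ)).2
  have hlev_eq : ∀ ξ η : ↥(O ∩ cube), (η : ℕ → ℝ) ∈ dyadicCell (lev ξ) ξ → lev η = lev ξ := by
    intro ξ η h
    have hle : lev η ≤ lev ξ :=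
      Nat.find_min' _ ⟨hlev₁ ξ, (dyadicCell_eq_of_mem le_rfl h).trans_subset (hlev₂ ξ)⟩
    exact hle.antisymm (Nat.find_min' _
      ⟨hlev₁ η, (dyadicCell_eq_of_mem hle h).symm.trans_subset (hlev₂ η)⟩)
  let mk : (N : ℕ) → ↥(O ∩ cube) → Σ N, Fin N → ℤ := fun N ξ => ⟨N, fun i => ⌊2 ^ N * ξ.1 i⌋⟩
  let code : ↥(O ∩ cube) → Σ N, Fin N → ℤ := fun ξ => mk (lev ξ) ξ
  have hcode₁ : ∀ ξ η : ↥(O ∩ cube), (η : ℕ → ℝ) ∈ dyadicCell (lev ξ) ξ → code η = code ξ := by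
    intro ξ η h
    change mk (lev η) η = mk (lev ξ) ξ
    rw [hlev_eq ξ η h]
    exact Sigma.ext rfl (heq_of_eq (funext fun i => h.2 i i.2))
  have hcode₂ : ∀ ξ η : ↥(O ∩ cube), code η = code ξ → (η : ℕ → ℝ) ∈ dyadicCell (lev ξ) ξ := by
    intro ξ η h
    refine ⟨η.2.2, fun i hi => ?_⟩
    have h1 : lev η = lev ξ := congrArg Sigma.fst h
    change mk (lev η) η = mk (lev ξ) ξ at h
    rw [h1] at h
    exact congrFun (eq_of_heq (Sigma.mk.inj h).2) ⟨i, hi⟩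
  choose rep hrep using fun p : Set.range code => p.2
  have hsub : ∀ p, dyadicCell (lev (rep p)) (rep p) ⊆ O ∩ cube :=
    fun p η hη => ⟨hlev₂ _ hη, hη.1⟩
  have hdisj : Pairwise (Function.onFun Disjoint fun p => dyadicCell (lev (rep p)) (rep p)) := by
    intro p q hpq
    refine Set.disjoint_left.2 fun ζ hp hq => hpq (Subtype.ext ?_)
    rw [← hrep p, ← hrep q, ← hcode₁ (rep p) ⟨ζ, hsub p hp⟩ hp,
      ← hcode₁ (rep q) ⟨ζ, hsub q hq⟩ hq]
  refine (preMu_le_tsum (ι := Set.range code)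
    (fun p => cylSet (dyadicLo (lev (rep p)) (rep p)) (dyadicHi (lev (rep p)) (rep p)))
    (fun p => bcVol (dyadicLo (lev (rep p)) (rep p)) (dyadicHi (lev (rep p)) (rep p)))
    (fun p => (isBCData_dyadic _ (rep p).2.2).isCylVol a)
    (fun p => hdiam (isBCData_dyadic _ (rep p).2.2) _ (hlev₁ (rep p))
      fun i hi => dyadicHi_sub_dyadicLo_le _ _ hi)
    (fun η hη => ?_) (K₀ := cylSet (fun _ => 0) fun i => if i < N₀ + 1 then 0 else 1) ?_ ?_).trans
    ?_
  · exact Set.mem_iUnion.2 ⟨⟨code ⟨η, hη⟩, _, rfl⟩, mem_cylSet_dyadic (hcode₂ _ ⟨η, hη⟩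
      (hrep ⟨code ⟨η, hη⟩, _, rfl⟩).symm)⟩
  · have h := hpad.isCylVol a
    rwa [bcVol_eq_zero hpad (i := 0) (by simp)] at h
  · refine hdiam hpad (N₀ + 1) (Nat.lt_succ_self _) fun i hi => ?_
    rw [if_pos hi, sub_zero]
    positivity
  · calc _ ≤ ∑' p : Set.range code, π (dyadicCell (lev (rep p)) (rep p)) :=
          ENNReal.tsum_le_tsum fun p => bcVol_dyadic_le π hπ _ (rep p).2.2
      _ = π (⋃ p, dyadicCell (lev (rep p)) (rep p)) :=
          (measure_iUnion hdisj fun p => measurableSet_dyadicCell _ _).symm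
      _ ≤ π (O ∩ cube) := measure_mono (Set.iUnion_subset hsub)

theorem preMu_mono (a : ℕ → ℝ) (δ : ℝ) {E F : Set (ℕ → ℝ)} (h : E ⊆ F) :
    preMu a δ E ≤ preMu a δ F :=
  sInf_le_sInf fun _ ⟨K, v, h1, h2, h3, h4⟩ => ⟨K, v, h1, h2, h.trans h3, h4⟩

open MeasureTheory in
theorem muA_le_measure (a : ℕ → ℝ) (hsum : Summable fun i => a i ^ 2) (π : Measure (ℕ → ℝ))
    (hπ : ∀ lo hi : ℕ → ℝ, IsBCData lo hi → π (cylSet lo hi) = ENNReal.ofReal (bcVol lo hi))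
    {E : Set (ℕ → ℝ)} (hE : E ⊆ cube) : muA a E ≤ π E := by
  have hfin : π cube ≠ ⊤ := by
    have h := hπ (fun _ => 0) (fun _ => 1) ⟨fun _ => le_rfl, fun _ => zero_le_one,
      fun _ => le_rfl, by simp⟩
    exact ne_of_eq_of_ne h ENNReal.ofReal_ne_top
  have : IsFiniteMeasure (π.restrict cube) := isFiniteMeasure_restrict.2 hfin
  refine iSup₂_le fun δ hδ => ENNReal.le_of_forall_pos_le_add fun ε hε _ => ?_
  obtain ⟨U, hEU, hU, hle⟩ := E.exists_isOpen_le_add (π.restrict cube)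
    (ENNReal.coe_ne_zero.2 hε.ne')
  rw [Measure.restrict_apply hU.measurableSet, Measure.restrict_eq_self π hE] at hle
  exact (preMu_mono a δ (Set.subset_inter hEU hE)).trans
    ((preMu_le_of_isOpen a hsum π hπ hU hδ).trans hle)

/-- The outer measure `μ` coincides with the standard product probability
measure `π` (characterized by `π(∏ᵢ[loᵢ,hiᵢ]) = ∏ᵢ(hiᵢ - loᵢ)` on basic
cylinders) on the Borel subsets of `I^ω`. -/
theorem ulam_stmt18 (a : ℕ → ℝ) (ha : ∀ i, 0 < a i)
    (hsum : Summable fun i => (a i) ^ 2)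
    (π : MeasureTheory.Measure (ℕ → ℝ))
    (hπ : ∀ lo hi : ℕ → ℝ, IsBCData lo hi →
      π (cylSet lo hi) = ENNReal.ofReal (bcVol lo hi))
    (E : Set (ℕ → ℝ)) (hE : E ⊆ cube) (hEm : MeasurableSet E) :
    muA a E = π E :=
  le_antisymm (muA_le_measure a hsum π hπ hE) (measure_le_muA a ha hsum π hπ hE)
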